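/- Let p ≥ 7 be a prime, and let n be a positive integer with n ≤ min{p−1, 1 + ⌊√(1 + p(p²−1)/168)⌋}. Then ed_ℂ(PSL_2(F_p); ≤ n) > 1. -/

import Mathlib

open IntermediateField Multiplicative

/-- `K` is (the function field of) an irreducible variety over `k`:
a finitely generated field extension of `k`. -/
def IsFunctionField (k K : Type) [Field k] [Field K] [Algebra k K] : Prop :=
  ∃ s : Finset K, IntermediateField.adjoin k (s : Set K) = ⊤

/-- The variety with function field `K` has dimension at most `d`, i.e. the
transcendence degree of `K/k` is at most `d`. -/
def DimLE (k K : Type) [Field k] [Field K] [Algebra k K] (d : ℕ) : Prop :=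
  ∃ s : Finset K, s.card ≤ d ∧ Algebra.IsAlgebraic (IntermediateField.adjoin k (s : Set K)) K

/-- `K` is the function field of an irreducible algebraic curve over `k`: a finitely
generated field extension of `k` of transcendence degree one. -/
def IsCurveField (k K : Type) [Field k] [Field K] [Algebra k K] : Prop :=
  IsFunctionField k K ∧ DimLE k K 1 ∧ ∃ x : K, Transcendental k x

/-- The rational function `f` on the curve with function field `K` has degree `n`,
i.e. the corresponding dominant rational map to `P¹` is generically `n`-to-1:
`[K : k(f)] = n` (in particular this extension is finite). -/
def RatFnDegree (k K : Type) [Field k] [Field K] [Algebra k K] (f : K) (n : ℕ) : Prop :=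
  FiniteDimensional (IntermediateField.adjoin k ({f} : Set K)) K ∧
    Module.finrank (IntermediateField.adjoin k ({f} : Set K)) K = n

/-- A faithful `G`-variety over `k`, in birational terms: a finitely generated
field extension `K/k` (the function field) equipped with a faithful `G`-action
on `K` by `k`-automorphisms (i.e. a faithful action on the variety by birational
automorphisms). -/
structure GVariety (k : Type) [Field k] (G : Type) [Group G] where
  K : Type
  [field : Field K]
  [algebra : Algebra k K]
  fg : IsFunctionField k K
  action : G →* (K ≃ₐ[k] K)
  faithful : Function.Injective action

attribute [instance] GVariety.field GVariety.algebra

section ED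

variable {k : Type} [Field k] {G : Type} [Group G]

/-- A `G`-compression `X ⇢ Y`: a dominant rational `G`-map, i.e. a `G`-equivariant
`k`-embedding of function fields `k(Y) ↪ k(X)`. -/
def GVariety.Compression (X Y : GVariety k G) : Prop :=
  ∃ φ : Y.K →ₐ[k] X.K, ∀ (g : G) (y : Y.K), X.action g (φ y) = φ (Y.action g y)

/-- `T ⇢ X` is a `G`-equivariant branched cover of degree at most `n`: a
`G`-equivariant `k`-embedding of function fields `k(X) ↪ k(T)` with
`[k(T) : k(X)] ≤ n`. -/
def GVariety.IsCoverDegLE (T X : GVariety k G) (n : ℕ) : Prop :=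
  ∃ ι : X.K →ₐ[k] T.K,
    FiniteDimensional ι.fieldRange T.K ∧ Module.finrank ι.fieldRange T.K ≤ n ∧
    ∀ (g : G) (x : X.K), T.action g (ι x) = ι (X.action g x)

end ED

/-- `ed_k(G; ≤ n) ≤ d`: every faithful `G`-variety `X` over `k` admits a
`G`-equivariant branched cover `X̃ ⇢ X` of degree at most `n` together with a
`G`-compression `X̃ ⇢ Y` to a faithful `G`-variety `Y` of dimension at most `d`.
Thus `ed_k(G; ≤ n) > d` is the negation `¬ EDLE k G n d`. -/
def EDLE (k : Type) [Field k] (G : Type) [Group G] (n d : ℕ) : Prop :=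
  ∀ X : GVariety k G, ∃ T Y : GVariety k G,
    T.IsCoverDegLE X n ∧ T.Compression Y ∧ DimLE k Y.K d

/-- Gauss's lemma for a valuation subring: the maximum of the values of the coefficients is
multiplicative (only the nontrivial inequality is stated). -/
theorem ValuationSubring.exists_coeff_mul_ge {K σ : Type*} [Field K] (O : ValuationSubring K)
    (f g : MvPolynomial σ K) (a b : σ →₀ ℕ) :
    ∃ m, O.valuation (f.coeff a) * O.valuation (g.coeff b) ≤ O.valuation ((f * g).coeff m) := by
  classical
  have normalize : ∀ f : MvPolynomial σ K, f ≠ 0 → ∃ (c : K) (F : MvPolynomial σ O),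
      f = MvPolynomial.C c * F.map (algebraMap O K) ∧
      (∀ a, O.valuation (f.coeff a) ≤ O.valuation c) ∧
      F.map (IsLocalRing.residue O) ≠ 0 := by
    intro f hf
    obtain ⟨α, hα, hmax⟩ := f.support.exists_max_image (fun a => O.valuation (f.coeff a))
      (MvPolynomial.support_nonempty.mpr hf)
    have hc : f.coeff α ≠ 0 := MvPolynomial.mem_support_iff.mp hα
    have hmax' : ∀ a, O.valuation (f.coeff a) ≤ O.valuation (f.coeff α) := fun a => by
      by_cases ha : a ∈ f.support
      · exact hmax a ha
      · rw [MvPolynomial.notMem_support_iff.mp ha]; simp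
    have hmem : MvPolynomial.C (f.coeff α)⁻¹ * f ∈
        Set.range (MvPolynomial.map (σ := σ) (algebraMap O K)) := by
      rw [MvPolynomial.mem_range_map_iff_coeffs_subset]
      intro x hx
      obtain ⟨m, -, rfl⟩ := MvPolynomial.mem_coeffs_iff.mp hx
      rw [MvPolynomial.coeff_C_mul]
      refine ⟨⟨_, (O.valuation_le_one_iff _).mp ?_⟩, rfl⟩
      erw [map_mul, map_inv₀]
      exact inv_mul_le_one_of_le₀ (hmax' m) zero_le
    obtain ⟨F, hF⟩ := hmem
    refine ⟨f.coeff α, F, ?_, hmax', fun h0 => ?_⟩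
    · rw [hF]
      rw [← mul_assoc, ← MvPolynomial.C_mul, mul_inv_cancel₀ hc, MvPolynomial.C_1, one_mul]
    · have h1 : (algebraMap O K) (F.coeff α) = 1 := by
        rw [← MvPolynomial.coeff_map]
        rw [hF]
        rw [MvPolynomial.coeff_C_mul, inv_mul_cancel₀ hc]
      have h2 : F.coeff α = 1 := Subtype.ext h1
      have h3 := congrArg (MvPolynomial.coeff α) h0
      rw [MvPolynomial.coeff_map, h2, map_one, MvPolynomial.coeff_zero] at h3
      exact one_ne_zero h3
  by_cases hf : f = 0
  · exact ⟨0, by simp [hf]⟩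
  by_cases hg : g = 0
  · exact ⟨0, by simp [hg]⟩
  obtain ⟨c, F, hfF, hfc, hF⟩ := normalize f hf
  obtain ⟨d, H, hgH, hgd, hH⟩ := normalize g hg
  have hFH : (F * H).map (IsLocalRing.residue O) ≠ 0 := by
    rw [map_mul]; exact mul_ne_zero hF hH
  obtain ⟨m, hm⟩ := MvPolynomial.ne_zero_iff.mp hFH
  refine ⟨m, ?_⟩
  have hu : O.valuation (algebraMap O K ((F * H).coeff m)) = 1 := by
    rw [MvPolynomial.coeff_map] at hm
    have := (IsLocalRing.residue_ne_zero_iff_isUnit _).mp hm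
    exact (O.valuation_eq_one_iff _).mp this
  have hfg : f * g = MvPolynomial.C (c * d) * (F * H).map (algebraMap O K) := by
    conv_lhs => rw [hfF, hgH]
    rw [map_mul, map_mul (MvPolynomial.map _)]
    ring
  rw [hfg, MvPolynomial.coeff_C_mul, MvPolynomial.coeff_map, map_mul, hu, mul_one, map_mul]
  exact mul_le_mul' (hfc a) (hgd b)

theorem exists_algebraMap_eq_of_isAlgebraic {k K : Type*} [Field k] [Field K] [Algebra k K]
    [IsAlgClosed k] {x : K} (hx : IsAlgebraic k x) : ∃ c, algebraMap k K c = x := by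
  have h := IsAlgClosed.degree_eq_one_of_irreducible k (minpoly.irreducible hx.isIntegral)
  exact minpoly.mem_range_of_degree_eq_one k x h

section BoundedCoeffs

attribute [local instance] MvPolynomial.algebraMvPolynomial

variable {k K σ : Type} [Field k] [Field K] [Algebra k K]

/-- An element lying in every valuation subring of `K` that contains `k` is algebraic over `k`. -/
theorem isAlgebraic_of_forall_mem_valuationSubring {x : K}
    (hx : ∀ O : ValuationSubring K, (∀ c : k, algebraMap k K c ∈ O) → x ∈ O) :
    IsAlgebraic k x := by
  have h1 : x ∈ (⨅ V : {V : ValuationSubring K // (Set.range (algebraMap k K)) ⊆ V.toSubring},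
      V.1.toSubring) := by
    rw [Subring.mem_iInf]
    exact fun V => hx V.1 fun c => V.2 ⟨c, rfl⟩
  rw [iInf_valuationSubring_superset] at h1
  have hcl : Subring.closure (Set.range (algebraMap k K)) = (algebraMap k K).range := by
    rw [← RingHom.coe_range, Subring.closure_eq]
  have h2 : IsIntegral (Subring.closure (Set.range (algebraMap k K))) x := h1
  rw [hcl] at h2
  obtain ⟨q, hq, hqx⟩ := h2
  have hsurj : Function.Surjective (algebraMap k K).rangeRestrict :=
    RingHom.rangeRestrict_surjective _
  obtain ⟨q', hq', -, hmon⟩ :=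
    Polynomial.lifts_and_natDegree_eq_and_monic
      ((Polynomial.mem_lifts _).mpr (Polynomial.map_surjective _ hsurj q)) hq
  refine (show IsIntegral k x from ⟨q', hmon, ?_⟩).isAlgebraic
  rw [← hqx, ← hq', Polynomial.eval₂_map]
  rfl

theorem coeff_smul_C (a : MvPolynomial σ k) (z : K) (m : σ →₀ ℕ) :
    (a • (MvPolynomial.C z : MvPolynomial σ K)).coeff m = a.coeff m • z := by
  rw [Algebra.smul_def, MvPolynomial.algebraMap_def, mul_comm, MvPolynomial.coeff_C_mul,
    MvPolynomial.coeff_map, mul_comm, Algebra.smul_def]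

/-- The polynomials over `K` all of whose coefficients have, at every valuation subring
of `K` containing `k`, at worst a pole of the order of `h ^ J`. -/
def boundedCoeffs (k σ : Type) {K : Type} [Field k] [Field K] [Algebra k K] (h : K) (J : ℕ) :
    Submodule (MvPolynomial σ k) (MvPolynomial σ K) where
  carrier := {p | ∀ O : ValuationSubring K, (∀ c : k, algebraMap k K c ∈ O) →
    ∀ m, O.valuation (p.coeff m) ≤ (max 1 (O.valuation h)) ^ J}
  zero_mem' := fun O _ m => by simp
  add_mem' := fun {a b} ha hb O hO m => by
    rw [MvPolynomial.coeff_add]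
    exact (O.valuation.map_add _ _).trans (max_le (ha O hO m) (hb O hO m))
  smul_mem' := fun a p hp O hO m => by
    classical
    rw [Algebra.smul_def, MvPolynomial.algebraMap_def, MvPolynomial.coeff_mul]
    refine O.valuation.map_sum_le fun x _ => ?_
    rw [map_mul, MvPolynomial.coeff_map]
    exact (mul_le_of_le_one_left' ((O.valuation_le_one_iff _).mpr (hO _))).trans (hp O hO _)

/-- Polynomials with everywhere regular coefficients are defined over the algebraically closed
base field. -/
theorem rank_boundedCoeffs_zero_le [IsAlgClosed k] (h : K) :
    Module.rank (MvPolynomial σ k) (boundedCoeffs k σ h 0) ≤ 1 := by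
  have hle : boundedCoeffs k σ h 0 ≤ Submodule.span (MvPolynomial σ k) {1} := by
    intro p hp
    have hmem : p ∈ Set.range (MvPolynomial.map (σ := σ) (algebraMap k K)) := by
      rw [MvPolynomial.mem_range_map_iff_coeffs_subset]
      intro x hx
      obtain ⟨m, -, rfl⟩ := MvPolynomial.mem_coeffs_iff.mp hx
      have halg : IsAlgebraic k (p.coeff m) :=
        isAlgebraic_of_forall_mem_valuationSubring fun O hO =>
          (O.valuation_le_one_iff _).mp (by simpa using hp O hO m)
      exact exists_algebraMap_eq_of_isAlgebraic halg
    obtain ⟨q, rfl⟩ := hmem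
    rw [Submodule.mem_span_singleton]
    exact ⟨q, by rw [Algebra.smul_def, MvPolynomial.algebraMap_def, mul_one]⟩
  exact (Submodule.rank_mono hle).trans ((rank_span_le _).trans (by simp))

variable {E : Type} [CommRing E] [Algebra (MvPolynomial σ k) E]

theorem rank_boundedCoeffs_le [IsAlgClosed k] (ε : MvPolynomial σ K →ₐ[MvPolynomial σ k] E)
    {Φ : MvPolynomial σ K} (hker : ∀ p, ε p = 0 → Φ ∣ p) {h : K}
    (hΦ : ∀ O : ValuationSubring K, (∀ c : k, algebraMap k K c ∈ O) →
      ∃ m, max 1 (O.valuation h) ≤ O.valuation (Φ.coeff m))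
    {n : ℕ} (hn : Module.rank (MvPolynomial σ k) E ≤ n) (J : ℕ) :
    Module.rank (MvPolynomial σ k) (boundedCoeffs k σ h J) ≤ (1 + J * n : ℕ) := by
  induction J with
  | zero => simpa using rank_boundedCoeffs_zero_le (σ := σ) h
  | succ J ih =>
    have hstep : boundedCoeffs k σ h (J + 1) ⊓ LinearMap.ker ε.toLinearMap ≤
        (boundedCoeffs k σ h J).map (LinearMap.mulLeft (MvPolynomial σ k) Φ) := by
      rintro p ⟨hp, hp0⟩
      obtain ⟨q, rfl⟩ := hker p hp0
      refine ⟨q, fun O hO m => ?_, rfl⟩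
      obtain ⟨a, ha⟩ := hΦ O hO
      obtain ⟨c, hc⟩ := O.exists_coeff_mul_ge Φ q a m
      have hpos : 0 < max 1 (O.valuation h) := lt_max_of_lt_left zero_lt_one
      have h1 := (mul_le_mul_left ha (O.valuation (q.coeff m))).trans (hc.trans (hp O hO c))
      rw [pow_succ'] at h1
      exact le_of_mul_le_mul_left h1 hpos
    have h1 := LinearMap.rank_range_add_rank_ker
      (ε.toLinearMap.domRestrict (boundedCoeffs k σ h (J + 1)))
    have h2 : Module.rank (MvPolynomial σ k)
        (LinearMap.ker (ε.toLinearMap.domRestrict (boundedCoeffs k σ h (J + 1)))) ≤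
        (1 + J * n : ℕ) := by
      refine le_trans ?_ (((Submodule.rank_mono hstep).trans (rank_map_le _ _)).trans ih)
      rw [LinearMap.ker_domRestrict, ← Submodule.map_comap_subtype,
        rank_map_eq (Submodule.subtype_injective _)]
    rw [← h1]
    calc _ ≤ ((n : ℕ) : Cardinal) + ((1 + J * n : ℕ) : Cardinal) :=
          add_le_add ((Submodule.rank_le _).trans hn) h2
      _ = _ := by rw [← Nat.cast_add]; congr 1; ring

end BoundedCoeffs

section RankBound

open Polynomial

attribute [local instance] MvPolynomial.algebraMvPolynomial

variable {k K σ : Type} [Field k] [Field K] [Algebra k K] [Algebra k[X] K] [IsScalarTower k k[X] K]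

theorem ValuationSubring.valuation_algebraMap_polynomial_le {O : ValuationSubring K}
    (hO : ∀ c : k, algebraMap k K c ∈ O) (r : k[X]) :
    O.valuation (algebraMap k[X] K r) ≤
      (max 1 (O.valuation (algebraMap k[X] K X))) ^ r.natDegree := by
  conv_lhs => rw [r.as_sum_range_C_mul_X_pow, map_sum]
  refine O.valuation.map_sum_le fun i hi => ?_
  rw [map_mul, map_mul, map_pow, map_pow, ← Polynomial.algebraMap_eq,
    ← IsScalarTower.algebraMap_apply k k[X] K]
  calc _ ≤ O.valuation (algebraMap k[X] K X) ^ i :=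
        mul_le_of_le_one_left' ((O.valuation_le_one_iff _).mpr (hO _))
    _ ≤ (max 1 (O.valuation (algebraMap k[X] K X))) ^ i :=
        pow_le_pow_left₀ zero_le (le_max_right _ _) _
    _ ≤ _ := pow_le_pow_right₀ (le_max_left _ _) (by
        rw [Finset.mem_range] at hi; omega)

/-- The poles of an element integral over `k[X]` are controlled by those of `X`. -/
theorem IsIntegral.exists_valuation_le {z : K} (hz : IsIntegral k[X] z) :
    ∃ c : ℕ, ∀ O : ValuationSubring K, (∀ c : k, algebraMap k K c ∈ O) →
      O.valuation z ≤ (max 1 (O.valuation (algebraMap k[X] K X))) ^ c := by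
  obtain ⟨q, hq, hqz⟩ := hz
  refine ⟨(Finset.range q.natDegree).sup fun i => (q.coeff i).natDegree, fun O hO => ?_⟩
  set M := max 1 (O.valuation (algebraMap k[X] K X))
  set c := (Finset.range q.natDegree).sup fun i => (q.coeff i).natDegree
  have hM : 1 ≤ M := le_max_left _ _
  by_contra! hlt
  have h1 : 1 ≤ O.valuation z := (one_le_pow₀ hM).trans hlt.le
  have hm : q.natDegree ≠ 0 := by
    intro h0
    rw [hq.natDegree_eq_zero.mp h0, eval₂_one] at hqz
    exact one_ne_zero hqz
  rw [eval₂_eq_sum_range, Finset.sum_range_succ, hq.coeff_natDegree, map_one, one_mul] at hqz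
  have h2 : O.valuation (z ^ q.natDegree) ≤ M ^ c * O.valuation z ^ (q.natDegree - 1) := by
    rw [eq_neg_of_add_eq_zero_right hqz, Valuation.map_neg]
    refine O.valuation.map_sum_le fun i hi => ?_
    rw [map_mul, map_pow]
    refine mul_le_mul' ?_ (pow_le_pow_right₀ h1 (by rw [Finset.mem_range] at hi; omega))
    exact (O.valuation_algebraMap_polynomial_le hO _).trans
      (pow_le_pow_right₀ hM (Finset.le_sup (f := fun i => (q.coeff i).natDegree) hi))
  have h3 : M ^ c * O.valuation z ^ (q.natDegree - 1) < O.valuation z ^ q.natDegree := by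
    conv_rhs => rw [← Nat.succ_pred_eq_of_ne_zero hm, pow_succ']
    exact mul_lt_mul_of_pos_right hlt (pow_pos (zero_lt_one.trans_le h1) _)
  rw [map_pow] at h2
  exact absurd h3 h2.not_gt

theorem rank_polynomial_le_of_rank_boundedCoeffs_le [FaithfulSMul k[X] K]
    [Algebra.IsAlgebraic k[X] K] {n : ℕ}
    (H : ∀ J : ℕ, Module.rank (MvPolynomial σ k)
      (boundedCoeffs k σ (algebraMap k[X] K X) J) ≤ (1 + J * n : ℕ)) :
    Module.rank k[X] K ≤ n := by
  refine rank_le fun s hs => ?_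
  obtain ⟨y, hy, hint⟩ := Algebra.IsAlgebraic.exists_integral_multiples k[X] s
  have hys : LinearIndependent k[X] fun i : s => y • (i : K) :=
    hs.map' (LinearMap.lsmul k[X] K y) (LinearMap.ker_lsmul hy)
  choose! c hc using fun (z : K) (hz : IsIntegral k[X] z) => hz.exists_valuation_le (k := k)
  set C := s.sup fun z => c (y • z)
  set h := algebraMap k[X] K X
  have key : ∀ J : ℕ, J * s.card ≤ 1 + (J + C) * n := by
    intro J
    have hX : LinearIndependent k fun j : Fin J => (X : k[X]) ^ (j : ℕ) := by
      have := (Polynomial.basisMonomials k).linearIndependent.comp _ (Fin.val_injective (n := J))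
      simpa [Function.comp_def, Polynomial.X_pow_eq_monomial] using this
    have hli := linearIndependent_smul hX hys
    have hmem : ∀ x : Fin J × s, (MvPolynomial.C ((X : k[X]) ^ (x.1 : ℕ) • y • (x.2 : K))
        : MvPolynomial σ K) ∈ boundedCoeffs k σ h (J + C) := by
      classical
      intro x O hO m
      have hM : 1 ≤ max 1 (O.valuation h) := le_max_left _ _
      rw [MvPolynomial.coeff_C]
      split_ifs
      · rw [Algebra.smul_def, map_mul, map_pow, map_pow, pow_add]
        refine mul_le_mul' ?_ ?_
        · exact (pow_le_pow_left₀ zero_le (le_max_right _ _) _).trans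
            (pow_le_pow_right₀ hM x.1.2.le)
        · exact (hc _ (hint _ x.2.2) O hO).trans
            (pow_le_pow_right₀ hM (Finset.le_sup (f := fun z => c (y • z)) x.2.2))
      · simp
    have hA : LinearIndependent (MvPolynomial σ k) fun x : Fin J × s =>
        (⟨_, hmem x⟩ : boundedCoeffs k σ h (J + C)) := by
      refine LinearIndependent.of_comp (Submodule.subtype _) ?_
      rw [Fintype.linearIndependent_iff] at hli ⊢
      intro a ha x
      ext m
      refine hli (fun x => (a x).coeff m) ?_ x
      rw [← MvPolynomial.coeff_zero m, ← ha, MvPolynomial.coeff_sum]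
      exact Finset.sum_congr rfl fun x _ => (coeff_smul_C _ _ _).symm
    have := hA.cardinal_le_rank.trans (H (J + C))
    rw [Cardinal.mk_fintype, Nat.cast_le] at this
    simpa using this
  have := key (2 + C * n)
  by_contra! hlt
  have h2 := Nat.mul_le_mul_left (2 + C * n) hlt
  rw [Nat.succ_eq_add_one] at h2
  nlinarith

end RankBound

section Dimension

open Polynomial

variable {k K : Type} [Field k] [Field K] [Algebra k K]

open scoped algebraAdjoinAdjoin in
theorem DimLE.trdeg_le {d : ℕ} (hd : DimLE k K d) : Algebra.trdeg k K ≤ d := by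
  obtain ⟨s, hs, halg⟩ := hd
  have : Algebra.IsAlgebraic (Algebra.adjoin k (s : Set K)) K :=
    (IsFractionRing.comap_isAlgebraic_iff (K := IntermediateField.adjoin k (s : Set K))).mpr halg
  refine (Algebra.IsAlgebraic.trdeg_le_cardinalMk k (s : Set K)).trans ?_
  simpa using hs

/-- On a curve every nonconstant function defines a finite map to the line. -/
theorem DimLE.isAlgebraic_polynomial (hd : DimLE k K 1) [Algebra k[X] K] [IsScalarTower k k[X] K]
    [FaithfulSMul k[X] K] : Algebra.IsAlgebraic k[X] K := by
  have htr : Transcendental k (algebraMap k[X] K X) := by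
    rw [transcendental_iff_injective]
    convert FaithfulSMul.algebraMap_injective k[X] K using 1
    ext q
    rw [aeval_algebraMap_apply, aeval_X_left_apply]
  have hind : AlgebraicIndependent k fun _ : Unit => algebraMap k[X] K X :=
    (algebraicIndependent_unique_type_iff (ι := Unit)).mpr htr
  have hb := hind.isTranscendenceBasis_of_trdeg_le_of_finite (by simpa using hd.trdeg_le)
  exact hb.isAlgebraic_iff.mpr fun _ => isAlgebraic_algebraMap X

/-- If `δ` has a nontrivial kernel on `K[σ]`, with `K` of dimension one, then the image of `δ`
is algebraic over `k[σ]`. -/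
theorem isAlgebraic_of_dimLE_one {σ D : Type} (hd : DimLE k K 1) [CommRing D] [IsDomain D]
    [Algebra (MvPolynomial σ k) D] (δ : MvPolynomial σ K →+* D)
    (hδ : ∀ a : MvPolynomial σ k, δ (a.map (algebraMap k K)) = algebraMap _ D a)
    {Φ : MvPolynomial σ K} (hΦ : Φ ≠ 0) (hΦδ : δ Φ = 0) (p : MvPolynomial σ K) :
    IsAlgebraic (MvPolynomial σ k) (δ p) := by
  have hC : ∀ z : K, IsAlgebraic (MvPolynomial σ k) (δ (MvPolynomial.C z)) := by
    intro z
    have haeval : ∀ q : k[X], aeval (δ (MvPolynomial.C z)) (q.map (MvPolynomial.C (σ := σ))) =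
        δ (MvPolynomial.C (aeval z q)) := by
      intro q
      induction q using Polynomial.induction_on' with
      | add q r hq hr => simp only [Polynomial.map_add, map_add, hq, hr]
      | monomial n c =>
        rw [map_monomial, aeval_monomial, aeval_monomial, map_mul, map_pow, map_mul, map_pow,
          ← hδ, MvPolynomial.map_C]
    by_cases hz : Transcendental k z
    · let _ : Algebra k[X] K := (aeval z).toAlgebra
      have : IsScalarTower k k[X] K := IsScalarTower.of_algebraMap_eq fun c => by
        simp [RingHom.algebraMap_toAlgebra]
      have : FaithfulSMul k[X] K := (faithfulSMul_iff_algebraMap_injective _ _).mpr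
        (transcendental_iff_injective.mp hz)
      have := hd.isAlgebraic_polynomial
      have hcomp : ∀ F : MvPolynomial (Option σ) k, aeval (δ (MvPolynomial.C z))
          (MvPolynomial.optionEquivLeft k σ F) =
          δ ((MvPolynomial.optionEquivRight k σ F).map (algebraMap k[X] K)) := by
        intro F
        induction F using MvPolynomial.induction_on with
        | C c =>
          rw [MvPolynomial.optionEquivLeft_C, MvPolynomial.optionEquivRight_C, MvPolynomial.map_C,
            aeval_C, ← hδ, MvPolynomial.map_C, RingHom.algebraMap_toAlgebra]
          simp
        | add F H hF hH => simp only [map_add, hF, hH]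
        | mul_X F i hF =>
          rw [map_mul, map_mul, hF, map_mul, map_mul, map_mul]
          congr 1
          cases i with
          | none => simp [RingHom.algebraMap_toAlgebra]
          | some i =>
            rw [MvPolynomial.optionEquivLeft_X_some, MvPolynomial.optionEquivRight_X_some,
              MvPolynomial.map_X, aeval_C, ← hδ, MvPolynomial.map_X]
      obtain ⟨f, hf, g, hg⟩ := MvPolynomial.exists_dvd_map_of_isAlgebraic (R := k[X]) hΦ
      have hf0 : δ (f.map (algebraMap k[X] K)) = 0 := by rw [hg, map_mul, hΦδ, zero_mul]
      refine ⟨MvPolynomial.optionEquivLeft k σ ((MvPolynomial.optionEquivRight k σ).symm f),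
        by rwa [Ne, EmbeddingLike.map_eq_zero_iff, EmbeddingLike.map_eq_zero_iff], ?_⟩
      rw [hcomp, AlgEquiv.apply_symm_apply, hf0]
    · obtain ⟨q, hq, hqz⟩ := not_not.mp hz
      refine ⟨q.map (MvPolynomial.C (σ := σ)), ?_, by rw [haeval, hqz, map_zero, map_zero]⟩
      rwa [Ne, Polynomial.map_eq_zero_iff (MvPolynomial.C_injective _ _)]
  induction p using MvPolynomial.induction_on with
  | C z => exact hC z
  | add p q hp hq => rw [map_add]; exact hp.add hq
  | mul_X p i hp =>
    rw [map_mul, ← MvPolynomial.map_X (algebraMap k K), hδ]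
    exact hp.mul (isAlgebraic_algebraMap _)

end Dimension

section PrincipalKernel

open Polynomial

attribute [local instance] MvPolynomial.algebraMvPolynomial

variable {k K σ E : Type} [Field k] [Field K] [Algebra k K]

theorem transcendental_C {θ : K} (hθ : Transcendental k θ) :
    Transcendental (MvPolynomial σ k) (MvPolynomial.C θ : MvPolynomial σ K) := by
  rw [transcendental_iff]
  intro q hq
  ext i m
  let r : ℕ → k := fun i => (q.coeff i).coeff m
  have hr : aeval θ (∑ i ∈ Finset.range (q.natDegree + 1), monomial i (r i)) = 0 := by
    rw [aeval_eq_sum_range] at hq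
    have := congrArg (MvPolynomial.coeff m) hq
    rw [MvPolynomial.coeff_sum, MvPolynomial.coeff_zero] at this
    rw [map_sum, ← this]
    refine Finset.sum_congr rfl fun i _ => ?_
    rw [← map_pow, coeff_smul_C, aeval_monomial, Algebra.smul_def]
  have h0 := (transcendental_iff.mp hθ) _ hr
  have hi := congrArg (fun f => f.coeff i) h0
  simp only [finsetSum_coeff, coeff_monomial, Finset.sum_ite_eq', coeff_zero, r,
    Finset.mem_range] at hi
  by_cases hlt : i < q.natDegree + 1
  · rw [if_pos hlt] at hi
    simpa using hi
  · rw [coeff_eq_zero_of_natDegree_lt (by omega)]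
    simp

variable [CommRing E] [IsDomain E] [Algebra (MvPolynomial σ k) E]

/-- The kernel of a map from `K[σ]`, with `K` of dimension one, to a domain that is algebraic
over `k[σ]` is generated by one prime polynomial. -/
theorem exists_prime_forall_eq_zero_iff_dvd (hd : DimLE k K 1) {θ : K} (hθ : Transcendental k θ)
    [FaithfulSMul (MvPolynomial σ k) E] [Algebra.IsAlgebraic (MvPolynomial σ k) E]
    (ε : MvPolynomial σ K →ₐ[MvPolynomial σ k] E) :
    ∃ Φ : MvPolynomial σ K, Prime Φ ∧ ∀ p, ε p = 0 ↔ Φ ∣ p := by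
  have hP : (RingHom.ker ε).IsPrime := RingHom.ker_isPrime ε
  have hbot : RingHom.ker ε ≠ ⊥ := by
    intro h
    rw [RingHom.ker_eq_bot_iff_eq_zero, ← injective_iff_map_eq_zero] at h
    exact transcendental_C hθ ((isAlgebraic_algHom_iff ε h).mp
      (Algebra.IsAlgebraic.isAlgebraic _))
  obtain ⟨Φ, hΦε, hΦ⟩ := hP.exists_mem_prime_of_ne_bot hbot
  refine ⟨Φ, hΦ, fun p => ⟨fun hp => ?_, ?_⟩⟩
  · let I := Ideal.span {Φ}
    have : I.IsPrime := (Ideal.span_singleton_prime hΦ.ne_zero).mpr hΦ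
    let mk := Ideal.Quotient.mk I
    by_contra hdvd
    have hmk : mk p ≠ 0 := by
      rwa [Ne, Ideal.Quotient.eq_zero_iff_mem, Ideal.mem_span_singleton]
    have halg : IsAlgebraic (MvPolynomial σ k) (mk p) :=
      isAlgebraic_of_dimLE_one hd mk (fun a => rfl) hΦ.ne_zero
        (Ideal.Quotient.eq_zero_iff_mem.mpr (Ideal.mem_span_singleton_self Φ)) p
    have hIk : I ≤ RingHom.ker ε := (Ideal.span_singleton_le_iff_mem _).mpr hΦε
    have hmem : mk p ∈ RingHom.ker (Ideal.Quotient.lift I (ε : MvPolynomial σ K →+* E) hIk) := by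
      rw [RingHom.mem_ker]
      exact hp
    refine Ideal.comap_ne_bot_of_algebraic_mem hmk hmem halg ?_
    rw [eq_bot_iff]
    intro a ha
    have : ε (algebraMap _ _ a) = 0 := ha
    rw [ε.commutes] at this
    exact (map_eq_zero_iff _ (FaithfulSMul.algebraMap_injective _ E)).mp this
  · rintro ⟨q, rfl⟩
    rw [map_mul, RingHom.mem_ker.mp hΦε, zero_mul]

end PrincipalKernel

section Eigenfunction

open Polynomial

theorem Module.End.exists_two_eigenvectors {k V : Type*} [Field k] [IsAlgClosed k]
    [AddCommGroup V] [Module k V] [FiniteDimensional k V] (f : Module.End k V) {N : ℕ}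
    (hN : (N : k) ≠ 0) (hf : f ^ N = 1) (hV : ∀ v : V, ∃ w, w ∉ Submodule.span k {v}) :
    ∃ v w : V, ∃ a b : k, f v = a • v ∧ f w = b • w ∧ v ≠ 0 ∧ w ∉ Submodule.span k {v} := by
  obtain ⟨w₀, hw₀⟩ := hV 0
  have : Nontrivial V := ⟨w₀, 0, fun h => hw₀ (by rw [h]; exact Submodule.zero_mem _)⟩
  obtain ⟨a, ha⟩ := Module.End.exists_eigenvalue f
  obtain ⟨v, hv⟩ := ha.exists_hasEigenvector
  have hss : f.IsSemisimple :=
    Module.End.isSemisimple_of_squarefree_aeval_eq_zero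
      (X_pow_sub_one_separable_iff.mpr hN).squarefree (by simp [hf])
  by_contra! hcon
  obtain ⟨w, hw⟩ := hV v
  have htop := Module.End.iSup_maxGenEigenspace_eq_top f
  simp_rw [hss.isFinitelySemisimple.maxGenEigenspace_eq_eigenspace] at htop
  have hle : (⨆ μ, f.eigenspace μ) ≤ Submodule.span k {v} :=
    iSup_le fun μ x hx =>
      hcon v x a μ hv.apply_eq_smul (Module.End.mem_eigenspace_iff.mp hx) hv.2
  exact hw (hle (htop ▸ Submodule.mem_top))

attribute [local instance] MvPolynomial.algebraMvPolynomial

variable {k K σ E : Type} [Field k] [Field K] [Algebra k K]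

theorem ValuationSubring.exists_le_valuation_coeff {O : ValuationSubring K}
    (hO : ∀ c : k, algebraMap k K c ∈ O) (Φ : MvPolynomial σ K) {w : K}
    (hw : w ∈ Submodule.span k (Set.range fun m => Φ.coeff m)) :
    ∃ m, O.valuation w ≤ O.valuation (Φ.coeff m) := by
  by_cases hΦ : Φ = 0
  · refine ⟨0, ?_⟩
    have : w = 0 := by simpa [hΦ] using hw
    simp [this]
  obtain ⟨m₀, -, hmax⟩ := Φ.support.exists_max_image (fun a => O.valuation (Φ.coeff a))
    (MvPolynomial.support_nonempty.mpr hΦ)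
  refine ⟨m₀, ?_⟩
  induction hw using Submodule.span_induction with
  | mem x hx =>
    obtain ⟨m, rfl⟩ := hx
    by_cases hm : m ∈ Φ.support
    · exact hmax m hm
    · simp [MvPolynomial.notMem_support_iff.mp hm]
  | zero => simp
  | add x y _ _ hx hy => exact (O.valuation.map_add x y).trans (max_le hx hy)
  | smul c x _ hx =>
    rw [Algebra.smul_def, map_mul]
    exact (mul_le_of_le_one_left' ((O.valuation_le_one_iff _).mpr (hO c))).trans hx

/-- The semilinear automorphism of `K[σ]` acting by `u` on coefficients and by the
permutation `π` on the variables. -/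
noncomputable def permAut (u : K ≃ₐ[k] K) (π : Equiv.Perm σ) :
    MvPolynomial σ K ≃+* MvPolynomial σ K :=
  (MvPolynomial.mapEquiv σ u.toRingEquiv).trans (MvPolynomial.renameEquiv K π).toRingEquiv

theorem coeff_permAut (u : K ≃ₐ[k] K) (π : Equiv.Perm σ) (p : MvPolynomial σ K) (m : σ →₀ ℕ) :
    (permAut u π p).coeff (m.mapDomain π) = u (p.coeff m) := by
  change (MvPolynomial.rename π (MvPolynomial.map _ p)).coeff _ = _
  rw [MvPolynomial.coeff_rename_mapDomain _ π.injective, MvPolynomial.coeff_map]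
  rfl

variable [CommRing E] [Algebra (MvPolynomial σ k) E]

/-- If the kernel of `ε` is generated by `Φ` and stable under a semilinear automorphism of finite
order, then the ratio of suitable combinations of the coefficients of `Φ` is a nonconstant
eigenfunction, and `Φ` may be normalized so that `1` and that ratio are combinations of its
coefficients. -/
theorem exists_eigenfunction [IsAlgClosed k] [FaithfulSMul (MvPolynomial σ k) E]
    (ε : MvPolynomial σ K →ₐ[MvPolynomial σ k] E) {Φ : MvPolynomial σ K} (hΦ0 : Φ ≠ 0)
    (hΦ : ∀ p, ε p = 0 ↔ Φ ∣ p) (u : K ≃ₐ[k] K) (π : Equiv.Perm σ)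
    (hε : ∀ p, ε (permAut u π p) = 0 ↔ ε p = 0) {N : ℕ} (hN : (N : k) ≠ 0) (hπ : π ^ N = 1) :
    ∃ (h : K) (c : k) (Ψ : MvPolynomial σ K), u h = algebraMap k K c * h ∧
      h ∉ Set.range (algebraMap k K) ∧ (∀ p, ε p = 0 → Ψ ∣ p) ∧
      1 ∈ Submodule.span k (Set.range fun m => Ψ.coeff m) ∧
      h ∈ Submodule.span k (Set.range fun m => Ψ.coeff m) := by
  have hassoc : Associated Φ (permAut u π Φ) := by
    refine associated_of_dvd_dvd ((hΦ _).mp ((hε _).mpr ((hΦ _).mpr dvd_rfl))) ?_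
    obtain ⟨q, hq⟩ := (permAut u π).surjective Φ
    have : Φ ∣ q := (hΦ _).mp ((hε _).mp (by rw [hq]; exact (hΦ _).mpr dvd_rfl))
    have := map_dvd (permAut u π) this
    rwa [hq] at this
  obtain ⟨U, hU⟩ := hassoc
  obtain ⟨r, hr, hrU⟩ := MvPolynomial.isUnit_iff_eq_C_of_isReduced.mp U.isUnit
  have hcoeff : ∀ m, r⁻¹ * u (Φ.coeff m) = Φ.coeff (m.mapDomain π) := by
    intro m
    rw [← coeff_permAut u π, ← hU, hrU, mul_comm Φ, MvPolynomial.coeff_C_mul,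
      inv_mul_cancel_left₀ hr.ne_zero]
  let W := Submodule.span k (Set.range fun m => Φ.coeff m)
  let ρ : K →ₗ[k] K := LinearMap.mulLeft k r⁻¹ ∘ₗ u.toLinearMap
  have hρW : ∀ w ∈ W, ρ w ∈ W := by
    intro w hw
    induction hw using Submodule.span_induction with
    | mem x hx =>
      obtain ⟨m, rfl⟩ := hx
      exact Submodule.subset_span ⟨_, (hcoeff m).symm⟩
    | zero => simp
    | add x y _ _ hx hy => rw [map_add]; exact W.add_mem hx hy
    | smul c x _ hx => rw [map_smul]; exact W.smul_mem c hx
  have hfin : FiniteDimensional k W := by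
    refine FiniteDimensional.span_of_finite k
      ((Φ.support.finite_toSet.image fun m => Φ.coeff m).insert 0 |>.subset ?_)
    rintro _ ⟨m, rfl⟩
    by_cases hm : m ∈ Φ.support
    · exact Or.inr ⟨m, hm, rfl⟩
    · exact Or.inl (MvPolynomial.notMem_support_iff.mp hm)
  have hρpow : (ρ.restrict hρW) ^ N = 1 := by
    have hm : ∀ (i : ℕ) (m : σ →₀ ℕ),
        (ρ ^ i) (Φ.coeff m) = Φ.coeff (m.mapDomain (π ^ i : Equiv.Perm σ)) := by
      intro i
      induction i with
      | zero => intro m; simp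
      | succ i ih =>
        intro m
        rw [pow_succ', Module.End.mul_apply, ih]
        refine (hcoeff _).trans ?_
        rw [← Finsupp.mapDomain_comp, pow_succ']
        rfl
    have hw : ∀ w ∈ W, (ρ ^ N) w = w := by
      intro w hw
      induction hw using Submodule.span_induction with
      | mem x hx =>
        obtain ⟨m, rfl⟩ := hx
        simp [hm, hπ]
      | zero => simp
      | add x y _ _ hx hy => rw [map_add, hx, hy]
      | smul c x _ hx => rw [map_smul, hx]
    ext w
    rw [Module.End.pow_restrict]
    exact hw w w.2
  obtain ⟨v, w, a, b, hva, hwb, hv0, hwv⟩ :=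
    Module.End.exists_two_eigenvectors (ρ.restrict hρW) hN hρpow (by
      by_contra! hcon
      obtain ⟨v, hv⟩ := hcon
      have hmul : ∀ m, ∃ c : k, algebraMap k K c * v = Φ.coeff m := by
        intro m
        obtain ⟨c, hc⟩ := Submodule.mem_span_singleton.mp
          (hv ⟨Φ.coeff m, Submodule.subset_span ⟨m, rfl⟩⟩)
        exact ⟨c, by rw [← Algebra.smul_def]; exact congrArg Subtype.val hc⟩
      have hv0 : (v : K) ≠ 0 := by
        rintro h0
        refine hΦ0 (MvPolynomial.ext _ _ fun m => ?_)
        obtain ⟨c, hc⟩ := hmul m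
        rw [← hc, h0, mul_zero, MvPolynomial.coeff_zero]
      have hmem : MvPolynomial.C (v : K)⁻¹ * Φ ∈
          Set.range (MvPolynomial.map (σ := σ) (algebraMap k K)) := by
        rw [MvPolynomial.mem_range_map_iff_coeffs_subset]
        intro x hx
        obtain ⟨m, -, rfl⟩ := MvPolynomial.mem_coeffs_iff.mp hx
        obtain ⟨c, hc⟩ := hmul m
        rw [MvPolynomial.coeff_C_mul, ← hc, mul_comm, mul_inv_cancel_right₀ hv0]
        exact ⟨c, rfl⟩
      obtain ⟨F, hF⟩ := hmem
      have hεF : ε (algebraMap _ _ F) = 0 := by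
        rw [MvPolynomial.algebraMap_def, hF]
        exact (hΦ _).mpr (dvd_mul_left _ _)
      rw [ε.commutes] at hεF
      have hF0 := (map_eq_zero_iff _ (FaithfulSMul.algebraMap_injective _ E)).mp hεF
      rw [hF0, map_zero] at hF
      exact (mul_ne_zero (by simpa using hv0) hΦ0) hF.symm)
  have hv0' : (v : K) ≠ 0 := fun h => hv0 (Subtype.ext h)
  have hva' : r⁻¹ * u v = algebraMap k K a * v := by
    rw [← Algebra.smul_def]; exact congrArg Subtype.val hva
  have hwb' : r⁻¹ * u w = algebraMap k K b * w := by
    rw [← Algebra.smul_def]; exact congrArg Subtype.val hwb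
  have hr0 := hr.ne_zero
  have ha0 : algebraMap k K a ≠ 0 := by
    intro h0
    rw [h0, zero_mul] at hva'
    exact mul_ne_zero (inv_ne_zero hr0) ((map_ne_zero u).mpr hv0') hva'
  have hspan : ∀ x ∈ W, (v : K)⁻¹ * x ∈
      Submodule.span k (Set.range fun m => (MvPolynomial.C (v : K)⁻¹ * Φ).coeff m) := by
    intro x hx
    induction hx using Submodule.span_induction with
    | mem x hx =>
      obtain ⟨m, rfl⟩ := hx
      exact Submodule.subset_span ⟨m, MvPolynomial.coeff_C_mul _ _ _⟩
    | zero => simp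
    | add x y _ _ hx hy => rw [mul_add]; exact Submodule.add_mem _ hx hy
    | smul c x _ hx => rw [mul_smul_comm]; exact Submodule.smul_mem _ c hx
  refine ⟨w / v, b / a, MvPolynomial.C (v : K)⁻¹ * Φ, ?_, ?_, ?_, ?_, ?_⟩
  · have huv : u v = r * (algebraMap k K a * v) := by rw [← hva', mul_inv_cancel_left₀ hr0]
    have huw : u w = r * (algebraMap k K b * w) := by rw [← hwb', mul_inv_cancel_left₀ hr0]
    rw [map_div₀, map_div₀, huv, huw]
    field_simp
  · rintro ⟨c, hc⟩
    refine hwv (Submodule.mem_span_singleton.mpr ⟨c, Subtype.ext ?_⟩)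
    change c • (v : K) = w
    rw [Algebra.smul_def, hc, div_mul_cancel₀ _ hv0']
  · intro p hp
    have hunit : IsUnit (MvPolynomial.C (v : K)⁻¹ : MvPolynomial σ K) :=
      (isUnit_iff_ne_zero.mpr (inv_ne_zero hv0')).map MvPolynomial.C
    exact (hunit.mul_left_dvd).mpr ((hΦ p).mp hp)
  · have := hspan v v.2
    rwa [inv_mul_cancel₀ hv0'] at this
  · have := hspan w w.2
    rwa [inv_mul_eq_div] at this

end Eigenfunction

section Zeros

open Polynomial

variable {k K : Type} [Field k] [Field K] [Algebra k K] {h : K}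

/-- The evaluation `X ↦ h`, as an algebra structure on `k(h)`. -/
noncomputable abbrev algebraPolynomialAdjoin (k : Type) {K : Type} [Field k] [Field K] [Algebra k K]
    (h : K) : Algebra k[X] k⟮h⟯ :=
  (aeval (AdjoinSimple.gen k h)).toAlgebra

/-- The evaluation `X ↦ h`, as an algebra structure on `K`. -/
noncomputable abbrev algebraPolynomial (k : Type) {K : Type} [Field k] [Field K] [Algebra k K]
    (h : K) : Algebra k[X] K :=
  (aeval h).toAlgebra

attribute [local instance] algebraPolynomialAdjoin in
theorem faithfulSMul_polynomial_adjoin (hh : Transcendental k h) : FaithfulSMul k[X] k⟮h⟯ := by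
  rw [faithfulSMul_iff_algebraMap_injective]
  refine transcendental_iff_injective.mp fun halg => ?_
  exact hh (by simpa using halg.algebraMap (A := K))

attribute [local instance] algebraPolynomialAdjoin in
theorem isFractionRing_polynomial_adjoin (hh : Transcendental k h) :
    IsFractionRing k[X] k⟮h⟯ := by
  have := faithfulSMul_polynomial_adjoin hh
  refine .of_field _ _ fun ⟨z, hz⟩ => ?_
  obtain ⟨r, s, rfl⟩ := (mem_adjoin_simple_iff k z).mp hz
  refine ⟨r, s, Subtype.ext ?_⟩
  change _ = algebraMap k⟮h⟯ K (aeval (AdjoinSimple.gen k h) r / aeval (AdjoinSimple.gen k h) s)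
  rw [map_div₀, ← aeval_algebraMap_apply, ← aeval_algebraMap_apply, AdjoinSimple.algebraMap_gen]

/-- The number of zeros of a function on a curve, counted with multiplicities, is at most its
degree. -/
theorem sum_card_le_finrank_adjoin [CharZero k] (hh : Transcendental k h)
    [FiniteDimensional k⟮h⟯ K] {ι : Type} [Fintype ι] {O : ι → ValuationSubring K}
    (hinj : Function.Injective O) (hO : ∀ i c, algebraMap k K c ∈ O i) (s : ι → Multiset K)
    (hs0 : ∀ i, s i ≠ 0) (hs1 : ∀ i, ∀ x ∈ s i, (O i).valuation x < 1)
    (hs : ∀ i, (s i).prod = h) :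
    ∑ i, (s i).card ≤ Module.finrank k⟮h⟯ K := by
  let := algebraPolynomialAdjoin k h
  let := algebraPolynomial k h
  have := faithfulSMul_polynomial_adjoin hh
  have := isFractionRing_polynomial_adjoin hh
  have htower : IsScalarTower k[X] k⟮h⟯ K := .of_algebraMap_eq fun q => by
    change aeval h q = algebraMap k⟮h⟯ K (aeval (AdjoinSimple.gen k h) q)
    rw [← aeval_algebraMap_apply, AdjoinSimple.algebraMap_gen]
  have : CharZero k⟮h⟯ := charZero_of_injective_algebraMap (algebraMap k _).injective
  let B := integralClosure k[X] K
  have : IsDedekindDomain B := integralClosure.isDedekindDomain k[X] k⟮h⟯ K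
  have : IsFractionRing B K := IsIntegralClosure.isFractionRing_of_finite_extension k[X] k⟮h⟯ K B
  have : Module.Finite k[X] B := IsIntegralClosure.finite k[X] k⟮h⟯ K B
  have : FaithfulSMul k[X] K := .trans k[X] k⟮h⟯ K
  have : FaithfulSMul k[X] B := .tower_bot k[X] B K
  let p : Ideal k[X] := Ideal.span {X}
  have hp : p.IsMaximal := PrincipalIdealRing.isMaximal_of_irreducible irreducible_X
  let x : B := algebraMap k[X] B X
  have hx : (x : K) = h := aeval_X h
  have hlt : ∀ i, (O i).valuation h < 1 := by
    intro i
    obtain ⟨y, hy⟩ := Multiset.exists_mem_of_ne_zero (hs0 i)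
    obtain ⟨t, ht⟩ := Multiset.exists_cons_of_mem hy
    rw [← hs i, ht, Multiset.prod_cons, map_mul]
    refine mul_lt_one_of_lt_of_le (hs1 i y hy) ?_
    rw [ValuationSubring.valuation_le_one_iff]
    refine multiset_prod_mem _ fun z hz => ?_
    rw [← ValuationSubring.valuation_le_one_iff]
    exact (hs1 i z (by rw [ht]; exact Multiset.mem_cons_of_mem hz)).le
  have hBO : ∀ i (b : B), (b : K) ∈ O i := by
    intro i b
    have hk : ∀ q : k[X], algebraMap k[X] K q ∈ O i := by
      intro q
      rw [← ValuationSubring.valuation_le_one_iff]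
      refine (ValuationSubring.valuation_algebraMap_polynomial_le (hO i) q).trans ?_
      rw [max_eq_left (by rw [show algebraMap k[X] K X = h from hx]; exact (hlt i).le), one_pow]
    obtain ⟨q, hq, hqb⟩ := b.2
    have hint : IsIntegral (O i) (b : K) := by
      refine ⟨q.map ((algebraMap k[X] K).codRestrict (O i) hk), hq.map _, ?_⟩
      rw [eval₂_map]
      exact hqb
    obtain ⟨y, hy⟩ := IsIntegrallyClosed.isIntegral_iff.mp hint
    rw [← hy]
    exact y.2
  -- The center of `O i` on `B`.
  let P : ι → Ideal B := fun i =>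
    (IsLocalRing.maximalIdeal (O i)).comap ((algebraMap B K).codRestrict (O i) (hBO i))
  have hPmem : ∀ i (b : B), b ∈ P i ↔ (O i).valuation b < 1 := fun i b =>
    (O i).valuation_lt_one_iff ⟨b, hBO i b⟩
  have hxP : ∀ i, x ∈ P i := fun i => (hPmem i x).mpr (by rw [hx]; exact hlt i)
  have hPprime : ∀ i, (P i).IsPrime := fun i => inferInstance
  have hx0 : x ≠ 0 := fun h0 => hh (by
    rw [← hx, h0]
    exact isAlgebraic_zero)
  have hP0 : ∀ i, P i ≠ ⊥ := fun i h0 => hx0 (by simpa [h0] using hxP i)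
  let v : ι → IsDedekindDomain.HeightOneSpectrum B := fun i => ⟨P i, hPprime i, hP0 i⟩
  have hOv : ∀ i, ((v i).valuation K).valuationSubring = O i := by
    intro i
    rw [← (v i).valuationSubringAtPrime_eq_valuationSubring]
    refine ValuationSubring.eq_of_le_of_ne_top _ ?_ ?_
    · rintro x ⟨a, s, hs, rfl⟩
      refine mul_mem (hBO i a) ?_
      rw [← ValuationSubring.valuation_le_one_iff, map_inv₀]
      have : ¬ (O i).valuation (s : K) < 1 := fun h1 => hs ((hPmem i s).mpr h1)
      exact inv_le_one_of_one_le₀ (not_lt.mp this)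
    · intro htop
      have h1 : h⁻¹ ∈ O i := htop ▸ ValuationSubring.mem_top _
      rw [← ValuationSubring.valuation_le_one_iff, map_inv₀] at h1
      have h0 : (O i).valuation h ≠ 0 :=
        (_root_.map_ne_zero _).mpr fun h0 => hh (h0 ▸ isAlgebraic_zero)
      exact ((one_lt_inv₀ (zero_lt_iff.mpr h0)).mpr (hlt i)).not_ge h1
  have hPinj : Function.Injective P := by
    intro i j hij
    have : v i = v j := IsDedekindDomain.HeightOneSpectrum.ext hij
    exact hinj (by rw [← hOv i, ← hOv j, this])
  have hover : ∀ i, (P i).LiesOver p := fun i =>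
    ⟨hp.eq_of_le (Ideal.comap_ne_top _ (hPprime i).ne_top)
      ((Ideal.span_singleton_le_iff_mem _).mpr (hxP i))⟩
  have hpow : ∀ i, x ∈ P i ^ (s i).card := by
    intro i
    have key : ∀ t : Multiset K, (∀ y ∈ t, (O i).valuation y < 1) →
        (v i).valuation K t.prod ≤ WithZero.exp (-(t.card : ℤ)) := by
      intro t ht
      induction t using Multiset.induction_on with
      | empty => simp
      | cons y t ih =>
        have hy : (v i).valuation K y < 1 := by
          have := ht y (Multiset.mem_cons_self y t)
          rw [← ValuationSubring.mem_nonunits_iff, ValuationSubring.mem_nonunits_iff_or,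
            ← hOv i, Valuation.mem_valuationSubring_iff, map_inv₀] at this
          obtain rfl | hy := this
          · simp
          · exact lt_of_not_ge fun h1 => hy (inv_le_one_of_one_le₀ h1)
        have hy' : (v i).valuation K y ≤ WithZero.exp (-1) := by
          refine (WithZero.lt_mul_exp_iff_le WithZero.exp_ne_zero).mp ?_
          rwa [← WithZero.exp_add, neg_add_cancel, WithZero.exp_zero]
        rw [Multiset.prod_cons, map_mul, Multiset.card_cons, Nat.cast_succ, neg_add_rev,
          WithZero.exp_add]
        exact mul_le_mul' hy' (ih fun z hz => ht z (Multiset.mem_cons_of_mem hz))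
    refine ((v i).intValuation_le_pow_iff_mem x _).mp ?_
    rw [← (v i).valuation_of_algebraMap (K := K)]
    have := key (s i) (hs1 i)
    rwa [hs i, ← hx] at this
  have hmap : p.map (algebraMap k[X] B) = Ideal.span {x} := by
    rw [Ideal.map_span, Set.image_singleton]
  have hmap0 : p.map (algebraMap k[X] B) ≠ ⊥ := by
    rw [hmap]
    simpa using hx0
  have hram : ∀ i, (s i).card ≤ (P i).ramificationIdx k[X] := by
    intro i
    rw [Ideal.IsDedekindDomain.ramificationIdx_eq_multiplicity p (P i) hmap0]
    refine FiniteMultiplicity.le_multiplicity_of_pow_dvd ?_ ?_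
    · exact FiniteMultiplicity.of_prime_left (Ideal.prime_of_isPrime (hP0 i) (hPprime i)) hmap0
    · rw [hmap, Ideal.dvd_span_singleton]
      exact hpow i
  let : Fintype (p.primesOver B) := (Algebra.QuasiFinite.finite_primesOver p).fintype
  rw [IsFractionRing.finrank_eq k[X] k⟮h⟯ B K, ← Ideal.sum_ramification_inertia_eq_finrank p]
  let Q : ι → p.primesOver B := fun i => ⟨P i, hPprime i, hover i⟩
  have hQ : Function.Injective Q := fun i j hij => hPinj (congrArg Subtype.val hij)
  calc ∑ i, (s i).card ≤ ∑ i, (Q i).1.ramificationIdx k[X] * (Q i).1.inertiaDeg k[X] :=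
        Finset.sum_le_sum fun i _ => (hram i).trans (Nat.le_mul_of_pos_right _
          (Ideal.inertiaDeg_pos _ _))
    _ ≤ _ := by
        rw [← Finset.sum_image (s := Finset.univ) (g := Q)
          (f := fun q : p.primesOver B => q.1.ramificationIdx k[X] * q.1.inertiaDeg k[X])
          hQ.injOn]
        exact Finset.sum_le_sum_of_subset (Finset.subset_univ _)

end Zeros

section EigenfunctionDegree

open Polynomial

attribute [local instance] MvPolynomial.algebraMvPolynomial

variable {k K σ E : Type} [Field k] [Field K] [Algebra k K]

theorem rank_adjoin_le_of_rank_polynomial_le {h : K} (hh : Transcendental k h) {n : ℕ}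
    (hn : @Module.rank k[X] K _ _ (algebraPolynomial k h).toModule ≤ n) :
    Module.rank k⟮h⟯ K ≤ n := by
  let := algebraPolynomialAdjoin k h
  let := algebraPolynomial k h
  have := faithfulSMul_polynomial_adjoin hh
  have htower : IsScalarTower k[X] k⟮h⟯ K := .of_algebraMap_eq fun q => by
    change aeval h q = algebraMap k⟮h⟯ K (aeval (AdjoinSimple.gen k h) q)
    rw [← aeval_algebraMap_apply, AdjoinSimple.algebraMap_gen]
  exact (rank_le_of_injective_injectiveₛ (algebraMap k[X] k⟮h⟯) (AddMonoidHom.id K)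
    (FaithfulSMul.algebraMap_injective _ _) Function.injective_id
    fun q x => algebraMap_smul k⟮h⟯ q x).trans hn

variable [CommRing E] [IsDomain E] [Algebra (MvPolynomial σ k) E]

/-- A `u`-equivariant compression of a cover of degree at most `n` of an affine space with permuted
coordinates to a curve yields a `u`-eigenfunction of degree at most `n` on the curve. -/
theorem exists_eigenfunction_finrank_le [IsAlgClosed k] (hd : DimLE k K 1) {θ : K}
    (hθ : Transcendental k θ) [FaithfulSMul (MvPolynomial σ k) E]
    [Algebra.IsAlgebraic (MvPolynomial σ k) E]
    (ε : MvPolynomial σ K →ₐ[MvPolynomial σ k] E) (u : K ≃ₐ[k] K) (π : Equiv.Perm σ)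
    (hε : ∀ p, ε (permAut u π p) = 0 ↔ ε p = 0) {N : ℕ} (hN : (N : k) ≠ 0) (hπ : π ^ N = 1)
    {n : ℕ} (hn : Module.rank (MvPolynomial σ k) E ≤ n) :
    ∃ (h : K) (c : k), u h = algebraMap k K c * h ∧ Transcendental k h ∧
      FiniteDimensional k⟮h⟯ K ∧ Module.finrank k⟮h⟯ K ≤ n := by
  obtain ⟨Φ, hΦ, hker⟩ := exists_prime_forall_eq_zero_iff_dvd hd hθ ε
  obtain ⟨h, c, Ψ, huh, hhk, hΨ, h1, hh⟩ := exists_eigenfunction ε hΦ.ne_zero hker u π hε hN hπ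
  have htr : Transcendental k h := fun halg =>
    hhk (exists_algebraMap_eq_of_isAlgebraic halg)
  let := algebraPolynomial k h
  have : IsScalarTower k k[X] K := .of_algebraMap_eq fun c => (aeval_C h c).symm
  have hX : algebraMap k[X] K X = h := aeval_X h
  have : FaithfulSMul k[X] K := by
    rw [faithfulSMul_iff_algebraMap_injective]
    exact transcendental_iff_injective.mp htr
  have := hd.isAlgebraic_polynomial
  have hrank : Module.rank k[X] K ≤ n := by
    refine rank_polynomial_le_of_rank_boundedCoeffs_le (k := k) (σ := σ) ?_
    rw [hX]
    refine rank_boundedCoeffs_le ε hΨ (fun O hO => ?_) hn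
    rcases le_total 1 (O.valuation h) with hle | hle
    · obtain ⟨m, hm⟩ := ValuationSubring.exists_le_valuation_coeff hO Ψ hh
      exact ⟨m, by rwa [max_eq_right hle]⟩
    · obtain ⟨m, hm⟩ := ValuationSubring.exists_le_valuation_coeff hO Ψ h1
      exact ⟨m, by rwa [max_eq_left hle, ← map_one O.valuation]⟩
  have hrank' := rank_adjoin_le_of_rank_polynomial_le htr hrank
  have hfin : FiniteDimensional k⟮h⟯ K :=
    Module.rank_lt_aleph0_iff.mp (hrank'.trans_lt (Cardinal.natCast_lt_aleph0))
  exact ⟨h, c, huh, htr, hfin, Module.finrank_le_of_rank_le hrank'⟩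

end EigenfunctionDegree

section Places

open Polynomial

variable {k K : Type} [Field k] [Field K] [Algebra k K] {h : K}

/-- Every nonconstant function on a curve has a zero. -/
theorem exists_valuation_lt_one (hh : Transcendental k h) :
    ∃ O : ValuationSubring K, (∀ c, algebraMap k K c ∈ O) ∧ O.valuation h < 1 := by
  let A : Subring K := (aeval (R := k) h).range.toSubring
  let x : A := ⟨h, X, aeval_X h⟩
  have hx : Ideal.span {x} ≠ ⊤ := by
    rw [Ne, Ideal.span_singleton_eq_top, isUnit_iff_exists_inv]
    rintro ⟨⟨_, q, rfl⟩, hq⟩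
    have hq' : aeval h (X * q - 1) = 0 := by
      rw [map_sub, map_mul, aeval_X, map_one, sub_eq_zero]
      exact congrArg Subtype.val hq
    have := congrArg (eval 0) (transcendental_iff.mp hh _ hq')
    simp at this
  obtain ⟨O, hAO, hO⟩ := Ideal.image_subset_nonunits_valuationSubring _ hx
  refine ⟨O, fun c => hAO ⟨C c, aeval_C h c⟩, ?_⟩
  rw [← ValuationSubring.mem_nonunits_iff]
  exact hO ⟨x, Ideal.mem_span_singleton_self x, rfl⟩

/-- If `K` is finite over `k(h)`, a zero of `h` is a rational point. -/
theorem exists_valuation_sub_lt_one [IsAlgClosed k] (hh : Transcendental k h)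
    [FiniteDimensional k⟮h⟯ K] {O : ValuationSubring K} (hO : ∀ c, algebraMap k K c ∈ O)
    (hOh : O.valuation h < 1) {f : K} (hf : f ∈ O) :
    ∃ c : k, O.valuation (f - algebraMap k K c) < 1 := by
  let := algebraPolynomialAdjoin k h
  let := algebraPolynomial k h
  have := isFractionRing_polynomial_adjoin hh
  have : IsScalarTower k[X] k⟮h⟯ K := .of_algebraMap_eq fun q => by
    change aeval h q = algebraMap k⟮h⟯ K (aeval (AdjoinSimple.gen k h) q)
    rw [← aeval_algebraMap_apply, AdjoinSimple.algebraMap_gen]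
  have : IsScalarTower k k[X] K := .of_algebraMap_eq fun c => (aeval_C h c).symm
  have hX : algebraMap k[X] K X = h := aeval_X h
  have halg : IsAlgebraic k[X] f := (IsFractionRing.isAlgebraic_iff k[X] k⟮h⟯ K).mpr
    (Algebra.IsAlgebraic.isAlgebraic f)
  obtain ⟨P, hP0, hP⟩ := halg
  have hprime : Prime (C X : k[X][X]) := prime_C_iff.mpr prime_X
  obtain ⟨Q, hPQ, hQ⟩ := (FiniteMultiplicity.of_prime_left hprime hP0).exists_eq_pow_mul_and_not_dvd
  have hQf : aeval f Q = 0 := by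
    rw [hPQ, map_mul, map_pow, aeval_C, hX] at hP
    refine (mul_eq_zero.mp hP).resolve_left (pow_ne_zero _ fun h0 => hh ?_)
    rw [h0]
    exact isAlgebraic_zero
  have hmem : ∀ q : k[X], algebraMap k[X] K q ∈ O := by
    intro q
    rw [← ValuationSubring.valuation_le_one_iff]
    refine (ValuationSubring.valuation_algebraMap_polynomial_le hO q).trans ?_
    rw [hX, max_eq_left hOh.le, one_pow]
  let a : k[X] →+* O := (algebraMap k[X] K).codRestrict O hmem
  let r : O →+* IsLocalRing.ResidueField O := IsLocalRing.residue O
  let : Algebra k (IsLocalRing.ResidueField O) := (r.comp (a.comp C)).toAlgebra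
  have hra : r.comp a = (algebraMap k (IsLocalRing.ResidueField O)).comp (evalRingHom 0) := by
    refine ringHom_ext (fun c => ?_) ?_
    · rw [RingHom.comp_apply, RingHom.comp_apply, coe_evalRingHom, eval_C]
      rfl
    · rw [RingHom.comp_apply, RingHom.comp_apply, coe_evalRingHom, eval_X, map_zero,
        IsLocalRing.residue_eq_zero_iff, ValuationSubring.valuation_lt_one_iff]
      change O.valuation (algebraMap k[X] K X) < 1
      rwa [hX]
  have hred : IsAlgebraic k (r ⟨f, hf⟩) := by
    refine ⟨Q.map (evalRingHom 0), fun h0 => hQ ?_, ?_⟩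
    · rw [C_dvd_iff_dvd_coeff]
      intro i
      rw [X_dvd_iff, coeff_zero_eq_eval_zero, ← coe_evalRingHom, ← coeff_map, h0, coeff_zero]
    · rw [aeval_def, eval₂_map, ← hra, ← hom_eval₂, IsLocalRing.residue_eq_zero_iff]
      have : eval₂ a ⟨f, hf⟩ Q = 0 := by
        refine Subtype.ext ((hom_eval₂ Q a O.subtype _).trans ?_)
        exact hQf
      rw [this]
      exact zero_mem _
  obtain ⟨c, hc⟩ := exists_algebraMap_eq_of_isAlgebraic hred
  refine ⟨c, ?_⟩
  have : r (⟨f, hf⟩ - a (C c)) = 0 := by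
    rw [map_sub, sub_eq_zero]
    exact hc.symm
  rw [IsLocalRing.residue_eq_zero_iff, ValuationSubring.valuation_lt_one_iff] at this
  convert this using 2
  change _ = f - algebraMap k[X] K (C c)
  rw [← algebraMap_eq, ← IsScalarTower.algebraMap_apply]

end Places

section Translates

open scoped Pointwise

variable {k K : Type} [Field k] [Field K] [Algebra k K] {h : K}

theorem valuation_smul_lt_one_iff (g : K ≃ₐ[k] K) (O : ValuationSubring K) (x : K) :
    (g • O).valuation x < 1 ↔ O.valuation (g⁻¹ x) < 1 := by
  rw [← ValuationSubring.mem_nonunits_iff, ← ValuationSubring.mem_nonunits_iff,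
    ValuationSubring.mem_nonunits_iff_or, ValuationSubring.mem_nonunits_iff_or,
    ValuationSubring.mem_pointwise_smul_iff_inv_smul_mem, AlgEquiv.smul_def, map_inv₀,
    map_eq_zero]

theorem algebraMap_mem_smul {O : ValuationSubring K} (hO : ∀ c : k, algebraMap k K c ∈ O)
    (g : K ≃ₐ[k] K) (c : k) : algebraMap k K c ∈ g • O := by
  rw [ValuationSubring.mem_pointwise_smul_iff_inv_smul_mem, AlgEquiv.smul_def, AlgEquiv.commutes]
  exact hO c

theorem valuation_lt_of_smul_eq {O : ValuationSubring K} {g : K ≃ₐ[k] K} (hg : g • O = O)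
    {x y : K} (hxy : O.valuation x < O.valuation y) : O.valuation (g x) < O.valuation (g y) := by
  have hy : y ≠ 0 := by
    rintro rfl
    simp at hxy
  have hy' : 0 < O.valuation y := zero_lt_iff.mpr ((map_ne_zero _).mpr hy)
  have hgy' : 0 < O.valuation (g y) :=
    zero_lt_iff.mpr ((map_ne_zero _).mpr ((map_ne_zero g).mpr hy))
  rw [← div_lt_one₀ hgy', ← map_div₀, ← map_div₀, ← hg, valuation_smul_lt_one_iff]
  change O.valuation (g.symm (g _)) < 1
  rwa [AlgEquiv.symm_apply_apply, map_div₀, div_lt_one₀ hy']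

/-- An automorphism of finite order which stabilizes a valuation ring preserves the valuation. -/
theorem valuation_eq_of_smul_eq {O : ValuationSubring K} {g : K ≃ₐ[k] K} (hg : g • O = O)
    (hfin : IsOfFinOrder g) (x : K) : O.valuation (g x) = O.valuation x := by
  have key : ∀ g : K ≃ₐ[k] K, g • O = O → IsOfFinOrder g → ∀ x,
      ¬ O.valuation (g x) < O.valuation x := by
    intro g hg hfin x hlt
    have hpow : ∀ m : ℕ, O.valuation ((g ^ (m + 1)) x) < O.valuation x := by
      intro m
      induction m with
      | zero => simpa using hlt
      | succ m ih =>
        rw [pow_succ', AlgEquiv.mul_apply]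
        exact (valuation_lt_of_smul_eq hg ih).trans hlt
    have := hpow (orderOf g - 1)
    rw [Nat.sub_add_cancel hfin.orderOf_pos, pow_orderOf_eq_one] at this
    exact lt_irrefl _ this
  refine le_antisymm (not_lt.mp fun hlt => ?_) (not_lt.mp (key g hg hfin x))
  refine key g⁻¹ (by rw [inv_smul_eq_iff, hg]) hfin.inv (g x) ?_
  rwa [show g⁻¹ (g x) = x from g.symm_apply_apply x]

theorem exists_multiset_prod_eq (O : ValuationSubring K) {c : ℕ} {x : Fin c → K}
    (hx0 : ∀ i, x i ≠ 0) (hx1 : ∀ i, O.valuation (x i) < 1)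
    (hx : StrictAnti fun i => O.valuation (x i)) (i : Fin c) :
    ∃ s : Multiset K, s.card = i + 1 ∧ (∀ y ∈ s, O.valuation y < 1) ∧ s.prod = x i := by
  obtain ⟨i, hi⟩ := i
  induction i with
  | zero => exact ⟨{x ⟨0, hi⟩}, by simp, by simpa using hx1 _, by simp⟩
  | succ i ih =>
    obtain ⟨s, hs, hs1, hprod⟩ := ih (by omega)
    refine ⟨(x ⟨i + 1, hi⟩ / x ⟨i, by omega⟩) ::ₘ s, by simp [hs], ?_, ?_⟩
    · intro y hy
      obtain rfl | hy := Multiset.mem_cons.mp hy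
      · rw [map_div₀, div_lt_one₀ (zero_lt_iff.mpr ((map_ne_zero _).mpr (hx0 _)))]
        exact hx (by simp)
      · exact hs1 y hy
    · rw [Multiset.prod_cons, hprod, div_mul_cancel₀ _ (hx0 _)]

/-- If the pullbacks of `h` along `c` automorphisms vanish at a place to different orders,
then `h` has at least `1 + 2 + ⋯ + c` zeros. -/
theorem card_mul_card_le_finrank [CharZero k] (hh : Transcendental k h) [FiniteDimensional k⟮h⟯ K]
    {O : ValuationSubring K} (hO : ∀ c : k, algebraMap k K c ∈ O) {ι : Type}
    (b : ι → K ≃ₐ[k] K) (hb : ∀ i j, IsOfFinOrder ((b j)⁻¹ * b i)) (T : Finset ι)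
    (hT : ∀ t ∈ T, O.valuation ((b t)⁻¹ h) < 1)
    (hinj : Set.InjOn (fun t => O.valuation ((b t)⁻¹ h)) T) :
    T.card * (T.card + 1) ≤ 2 * Module.finrank k⟮h⟯ K := by
  classical
  have hh0 : h ≠ 0 := fun h0 => hh (h0 ▸ isAlgebraic_zero)
  let V := T.image fun t => O.valuation ((b t)⁻¹ h)
  have hV : V.card = T.card := Finset.card_image_of_injOn hinj
  choose t htT ht using fun i : Fin T.card =>
    Finset.mem_image.mp (Finset.orderEmbOfFin_mem V hV i.rev)
  have hanti : StrictAnti fun i => O.valuation ((b (t i))⁻¹ h) := by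
    intro i j hij
    simp only [ht]
    exact (V.orderEmbOfFin hV).strictMono (Fin.rev_lt_rev.mpr hij)
  choose s hs hs1 hprod using exists_multiset_prod_eq O (x := fun i => (b (t i))⁻¹ h)
    (fun i => (map_ne_zero _).mpr hh0) (fun i => hT _ (htT i)) hanti
  have hdist : Function.Injective fun i => b (t i) • O := by
    intro i j hij
    refine hanti.injective ?_
    have hg : ((b (t j))⁻¹ * b (t i)) • O = O := by
      rw [mul_smul, inv_smul_eq_iff]
      exact hij
    have := valuation_eq_of_smul_eq hg (hb _ _) ((b (t i))⁻¹ h)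
    rw [← AlgEquiv.mul_apply, mul_inv_cancel_right] at this
    exact this.symm
  have hsum := sum_card_le_finrank_adjoin hh hdist (fun i c => algebraMap_mem_smul hO _ c)
    (fun i => (s i).map (b (t i))) (fun i h0 => ?_) (fun i x hx => ?_) (fun i => ?_)
  · simp only [Multiset.card_map, hs] at hsum
    rw [Fin.sum_univ_eq_sum_range (fun i => i + 1)] at hsum
    have hgauss := Finset.sum_range_id_mul_two (T.card + 1)
    rw [Finset.sum_range_succ', add_zero, Nat.add_sub_cancel] at hgauss
    rw [mul_comm T.card, ← hgauss, mul_comm]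
    exact Nat.mul_le_mul_left 2 hsum
  · have := hs i
    rw [Multiset.map_eq_zero.mp h0] at this
    simp at this
  · obtain ⟨y, hy, rfl⟩ := Multiset.mem_map.mp hx
    rw [valuation_smul_lt_one_iff, show (b (t i))⁻¹ (b (t i) y) = y from
      (b (t i)).symm_apply_apply y]
    exact hs1 i y hy
  · rw [← map_multiset_prod, hprod]
    exact (b (t i)).apply_symm_apply h

/-- If `h` is an eigenfunction of an automorphism of prime order `p` exceeding the degree of `h`,
then the eigenvalue is nontrivial. -/
theorem eigenvalue_ne_one {p : ℕ} [FiniteDimensional k⟮h⟯ K]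
    {u : K ≃ₐ[k] K} (hu : orderOf u = p) (hp : Module.finrank k⟮h⟯ K < p) : u h ≠ h := by
  intro huh
  have hle : Subgroup.zpowers u ≤ k⟮h⟯.fixingSubgroup := by
    rw [Subgroup.zpowers_le, IntermediateField.mem_fixingSubgroup_iff]
    intro x hx
    induction hx using adjoin_induction with
    | mem x hx => rw [Set.mem_singleton_iff.mp hx]; exact huh
    | algebraMap c => exact u.commutes c
    | add x y _ _ hx hy => exact (map_add u x y).trans (congrArg₂ _ hx hy)
    | inv x _ hx => exact (map_inv₀ u x).trans (congrArg _ hx)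
    | mul x y _ _ hx hy => exact (map_mul u x y).trans (congrArg₂ _ hx hy)
  have hfin : Finite k⟮h⟯.fixingSubgroup := (fixingSubgroupEquiv k⟮h⟯).toEquiv.finite_iff.mpr
    inferInstance
  have h1 := Subgroup.card_le_of_le hle
  rw [Nat.card_zpowers, hu, Nat.card_congr (fixingSubgroupEquiv k⟮h⟯).toEquiv] at h1
  have h2 : Nat.card (K ≃ₐ[k⟮h⟯] K) ≤ Module.finrank k⟮h⟯ K := by
    rw [Nat.card_eq_fintype_card]
    exact AlgEquiv.card_le
  omega

theorem pow_apply_eigen {u : K ≃ₐ[k] K} {a : k} (huh : u h = algebraMap k K a * h) (i : ℕ) :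
    (u ^ i) h = algebraMap k K (a ^ i) * h := by
  induction i with
  | zero => simp
  | succ i ih =>
    rw [pow_succ', AlgEquiv.mul_apply, ih, map_mul, AlgEquiv.commutes, huh, pow_succ, map_mul,
      mul_assoc]

/-- A zero of an eigenfunction `h` of an automorphism of prime order exceeding the degree of `h`
is a fixed point of the automorphism. -/
theorem smul_eq_of_eigen [CharZero k] {p : ℕ} [Fact p.Prime] (hh : Transcendental k h)
    [FiniteDimensional k⟮h⟯ K] {u : K ≃ₐ[k] K} (hu : u ^ p = 1)
    (hp : Module.finrank k⟮h⟯ K < p) {a : k} (huh : u h = algebraMap k K a * h)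
    {O : ValuationSubring K} (hO : ∀ c : k, algebraMap k K c ∈ O) (hOh : O.valuation h < 1) :
    u • O = O := by
  by_contra hne
  have hper : MulAction.period u O = p := by
    refine ((Nat.dvd_prime Fact.out).mp (MulAction.pow_smul_eq_iff_period_dvd.mp ?_)).resolve_left
      (fun h1 => hne (MulAction.period_eq_one_iff.mp h1))
    rw [hu, one_smul]
  have hinj : Function.Injective fun i : Fin p => u ^ (i : ℕ) • O := by
    intro i j hij
    have hdvd : (MulAction.period u O : ℤ) ∣ (j : ℤ) - i := by
      rw [← MulAction.zpow_smul_eq_iff_period_dvd, sub_eq_neg_add, zpow_add, mul_smul,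
        zpow_neg, inv_smul_eq_iff, zpow_natCast, zpow_natCast]
      exact hij.symm
    rw [hper] at hdvd
    have := (Nat.modEq_iff_dvd.mpr hdvd).eq_of_lt_of_lt i.2 j.2
    exact Fin.ext this
  have hsum := sum_card_le_finrank_adjoin hh hinj (fun i c => algebraMap_mem_smul hO _ c)
    (fun _ => {h}) (fun _ => Multiset.singleton_ne_zero h) (fun i x hx => ?_)
    (fun _ => Multiset.prod_singleton h)
  · simp at hsum
    omega
  · obtain rfl := Multiset.mem_singleton.mp hx
    have ha : a ≠ 0 := by
      rintro rfl
      rw [map_zero, zero_mul, map_eq_zero] at huh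
      exact hh (huh ▸ isAlgebraic_zero)
    have hinv : (u ^ (i : ℕ))⁻¹ x = algebraMap k K ((a ^ (i : ℕ))⁻¹) * x := by
      refine (u ^ (i : ℕ)).injective ?_
      rw [map_mul, AlgEquiv.commutes, pow_apply_eigen huh, ← mul_assoc, ← map_mul,
        inv_mul_cancel₀ (pow_ne_zero _ ha), map_one, one_mul]
      exact (u ^ (i : ℕ)).apply_symm_apply x
    rw [valuation_smul_lt_one_iff, hinv, map_mul]
    exact (mul_le_of_le_one_left' ((O.valuation_le_one_iff _).mpr (hO _))).trans_lt hOh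

end Translates

section Counting

open scoped Pointwise

variable {k K : Type} [Field k] [Field K] [Algebra k K] {h : K}

theorem valuation_algebraMap_eq_one {O : ValuationSubring K} (hO : ∀ c : k, algebraMap k K c ∈ O)
    {c : k} (hc : c ≠ 0) : O.valuation (algebraMap k K c) = 1 := by
  refine le_antisymm ((O.valuation_le_one_iff _).mpr (hO c)) ?_
  have := (O.valuation_le_one_iff _).mpr (hO c⁻¹)
  rwa [map_inv₀, map_inv₀, inv_le_one₀ (zero_lt_iff.mpr ?_)] at this
  simpa using hc

/-- An eigenfunction which is a unit at a fixed point has eigenvalue one. -/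
theorem eigenvalue_eq_one_of_valuation_eq_one [IsAlgClosed k] (hh : Transcendental k h)
    [FiniteDimensional k⟮h⟯ K] {O : ValuationSubring K} (hO : ∀ c : k, algebraMap k K c ∈ O)
    (hOh : O.valuation h < 1) {u : K ≃ₐ[k] K} (hu : u • O = O) {f : K} {a : k}
    (hf : u f = algebraMap k K a * f) (hOf : O.valuation f = 1) : a = 1 := by
  obtain ⟨c, hc⟩ := exists_valuation_sub_lt_one hh hO hOh
    ((O.valuation_le_one_iff f).mp hOf.le)
  have hc0 : c ≠ 0 := by
    rintro rfl
    rw [map_zero, sub_zero, hOf] at hc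
    exact lt_irrefl _ hc
  by_contra ha
  have h1 : O.valuation (u (f - algebraMap k K c)) < 1 := by
    have := valuation_lt_of_smul_eq hu (hc.trans_eq (map_one O.valuation).symm)
    rwa [map_one, map_one] at this
  have h2 : O.valuation (algebraMap k K a * (f - algebraMap k K c)) < 1 := by
    rw [map_mul]
    exact (mul_le_of_le_one_left' ((O.valuation_le_one_iff _).mpr (hO _))).trans_lt hc
  have h3 := (O.valuation.map_sub _ _).trans_lt (max_lt h1 h2)
  rw [map_sub u, hf, AlgEquiv.commutes,
    show algebraMap k K a * f - algebraMap k K c - algebraMap k K a * (f - algebraMap k K c) =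
      algebraMap k K ((a - 1) * c) by simp only [map_mul, map_sub, map_one]; ring,
    valuation_algebraMap_eq_one hO (mul_ne_zero (sub_ne_zero.mpr ha) hc0)] at h3
  exact lt_irrefl _ h3

/-- If `h` is an eigenfunction of `u` of degree less than the prime order of `u`, and `u` has
`2 c - 1` distinct powers conjugate to it, then the degree of `h` is at least `c (c + 1) / 2`. -/
theorem mul_succ_le_two_mul_finrank [IsAlgClosed k] [CharZero k] {p : ℕ} [Fact p.Prime]
    (hh : Transcendental k h) [FiniteDimensional k⟮h⟯ K] {u : K ≃ₐ[k] K} (hu : orderOf u = p)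
    (hp : Module.finrank k⟮h⟯ K < p) {a : k} (huh : u h = algebraMap k K a * h)
    {ι : Type} [Fintype ι] (b : ι → K ≃ₐ[k] K) (hb : ∀ i j, IsOfFinOrder ((b j)⁻¹ * b i))
    (s : ι → ℕ) (hbs : ∀ i, u * (b i)⁻¹ = (b i)⁻¹ * u ^ s i) (hs0 : ∀ i, ¬ p ∣ s i)
    (hs : ∀ i j, s i ≡ s j [MOD p] → i = j) {c : ℕ} (hc : 2 * c ≤ Fintype.card ι + 1) :
    c * (c + 1) ≤ 2 * Module.finrank k⟮h⟯ K := by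
  classical
  have hh0 : h ≠ 0 := fun h0 => hh (h0 ▸ isAlgebraic_zero)
  have hup : u ^ p = 1 := by rw [← hu, pow_orderOf_eq_one]
  have ha : orderOf a = p := by
    refine orderOf_eq_prime ?_ fun ha1 => eigenvalue_ne_one hu hp (by rw [huh, ha1, map_one, one_mul])
    have := pow_apply_eigen huh p
    rw [hup, AlgEquiv.one_apply, eq_comm, mul_eq_right₀ hh0] at this
    exact (algebraMap k K).injective (this.trans (map_one _).symm)
  have ha0 : a ≠ 0 := by
    rintro rfl
    rw [orderOf_zero] at ha
    exact (Fact.out : p.Prime).ne_zero ha.symm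
  obtain ⟨O, hO, hOh⟩ := exists_valuation_lt_one hh
  have huO := smul_eq_of_eigen hh hup hp huh hO hOh
  have heig : ∀ i, u ((b i)⁻¹ h) = algebraMap k K (a ^ s i) * (b i)⁻¹ h := by
    intro i
    rw [← AlgEquiv.mul_apply, hbs, AlgEquiv.mul_apply, pow_apply_eigen huh, map_mul,
      AlgEquiv.commutes]
  have hb0 : ∀ i, (b i)⁻¹ h ≠ 0 := fun i => (map_ne_zero _).mpr hh0
  have hne : ∀ i, O.valuation ((b i)⁻¹ h) ≠ 1 := fun i hi => hs0 i <| by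
    rw [← ha, orderOf_dvd_iff_pow_eq_one]
    exact eigenvalue_eq_one_of_valuation_eq_one hh hO hOh huO (heig i) hi
  have hinj : Function.Injective fun i => O.valuation ((b i)⁻¹ h) := by
    intro i j hij
    refine hs i j ?_
    rw [← ha, ← Units.val_mk0 ha0, orderOf_units, ← pow_eq_pow_iff_modEq, Units.ext_iff,
      Units.val_pow_eq_pow_val, Units.val_pow_eq_pow_val, Units.val_mk0]
    refine (div_eq_one_iff_eq (pow_ne_zero _ ha0)).mp
      (eigenvalue_eq_one_of_valuation_eq_one hh hO hOh huO
        (f := (b i)⁻¹ h / (b j)⁻¹ h) ?_ ?_)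
    · rw [map_div₀, heig, heig, map_div₀, mul_div_mul_comm]
    · rw [map_div₀, div_eq_one_iff_eq ((map_ne_zero _).mpr (hb0 j))]
      exact hij
  have hcard : c ≤ (Finset.univ.filter fun i => O.valuation ((b i)⁻¹ h) < 1).card ∨
      c ≤ (Finset.univ.filter fun i => ¬ O.valuation ((b i)⁻¹ h) < 1).card := by
    have := Finset.card_filter_add_card_filter_not (s := (Finset.univ : Finset ι))
      fun i => O.valuation ((b i)⁻¹ h) < 1
    rw [Finset.card_univ] at this
    omega
  obtain hcard | hcard := hcard
  · refine le_trans (Nat.mul_le_mul hcard (Nat.succ_le_succ hcard))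
      (card_mul_card_le_finrank hh hO b hb _ (fun t ht => (Finset.mem_filter.mp ht).2) hinj.injOn)
  · have hadj : k⟮h⁻¹⟯ = k⟮h⟯ := by
      refine le_antisymm ?_ ?_ <;> rw [adjoin_simple_le_iff]
      · exact inv_mem (mem_adjoin_simple_self k h)
      · exact inv_mem_iff.mp (mem_adjoin_simple_self k h⁻¹)
    have hfin : FiniteDimensional k⟮h⁻¹⟯ K := hadj ▸ inferInstance
    rw [← hadj]
    refine le_trans (Nat.mul_le_mul hcard (Nat.succ_le_succ hcard))
      (card_mul_card_le_finrank (fun halg => hh (by simpa using halg.inv)) hO b hb _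
        (fun t ht => ?_) fun i _ j _ hij => hinj ?_)
    · rw [map_inv₀, map_inv₀, inv_lt_one₀ (zero_lt_iff.mpr ((map_ne_zero _).mpr (hb0 t)))]
      exact (hne t).symm.lt_of_le (not_lt.mp (Finset.mem_filter.mp ht).2)
    · simpa using hij

end Counting

section RegularRepresentation

attribute [local instance] MvPolynomial.algebraMvPolynomial

/-- The action of `G` on the polynomial ring whose variables are permuted as in the regular
representation. -/
noncomputable def regularAction (k G : Type) [Field k] [Group G] :
    G →* (MvPolynomial G k ≃ₐ[k] MvPolynomial G k) where
  toFun g := MvPolynomial.renameEquiv k (MulAction.toPerm g)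
  map_one' := by
    refine AlgEquiv.coe_toAlgHom_injective (MvPolynomial.algHom_ext fun x => ?_)
    simp
  map_mul' g g' := by
    refine AlgEquiv.coe_toAlgHom_injective (MvPolynomial.algHom_ext fun x => ?_)
    simp [mul_assoc]

theorem regularAction_X {k G : Type} [Field k] [Group G] (g x : G) :
    regularAction k G g (MvPolynomial.X x) = MvPolynomial.X (g * x) :=
  MvPolynomial.rename_X _ _

theorem regularAction_injective (k G : Type) [Field k] [Group G] :
    Function.Injective (regularAction k G) := by
  intro g g' hgg
  have := regularAction_X (k := k) g 1
  rw [hgg, regularAction_X, mul_one, mul_one] at this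
  exact (MvPolynomial.X_injective this).symm

/-- The regular representation of a finite group, as a faithful variety. -/
noncomputable def GVariety.regular (k G : Type) [Field k] [Group G] [Finite G] : GVariety k G where
  K := FractionRing (MvPolynomial G k)
  fg := by
    have : Algebra.EssFiniteType (MvPolynomial G k) (FractionRing (MvPolynomial G k)) :=
      .of_isLocalization _ (nonZeroDivisors _)
    have : Algebra.EssFiniteType k (FractionRing (MvPolynomial G k)) :=
      .comp k (MvPolynomial G k) _
    exact fg_top k _
  action := (IsFractionRing.fieldEquivOfAlgEquivHom k _).comp (regularAction k G)
  faithful := (IsFractionRing.fieldEquivOfAlgEquivHom_injective _ _ _ _).comp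
    (regularAction_injective k G)

/-- If the regular representation has a cover of degree at most `n` compressing to a curve `Y`, then
every element of the group has a nonconstant eigenfunction of degree at most `n` on `Y`. -/
theorem exists_eigenfunction_of_compression {k G : Type} [Field k] [IsAlgClosed k] [CharZero k]
    [Group G] [Finite G] [Nontrivial G] {n : ℕ} {T Y : GVariety k G}
    (hT : T.IsCoverDegLE (GVariety.regular k G) n) (hY : T.Compression Y) (hd : DimLE k Y.K 1)
    (g : G) : ∃ (h : Y.K) (a : k), Y.action g h = algebraMap k Y.K a * h ∧ Transcendental k h ∧
      FiniteDimensional k⟮h⟯ Y.K ∧ Module.finrank k⟮h⟯ Y.K ≤ n := by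
  let X := FractionRing (MvPolynomial G k)
  obtain ⟨ι, hfin, hn, hι⟩ : ∃ ι : X →ₐ[k] T.K,
      FiniteDimensional ι.fieldRange T.K ∧ Module.finrank ι.fieldRange T.K ≤ n ∧
      ∀ (g : G) (x : X), T.action g (ι x) =
        ι (IsFractionRing.fieldEquivOfAlgEquivHom k X (regularAction k G g) x) := hT
  obtain ⟨φ, hφ⟩ := hY
  obtain ⟨θ, hθ⟩ : ∃ θ : Y.K, Transcendental k θ := by
    by_contra! halg
    obtain ⟨g, hg⟩ := exists_ne (1 : G)
    refine hg (Y.faithful (AlgEquiv.ext fun x => ?_))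
    obtain ⟨c, rfl⟩ := exists_algebraMap_eq_of_isAlgebraic (not_not.mp (halg x))
    rw [AlgEquiv.commutes, AlgEquiv.commutes]
  let : Algebra X T.K := ι.toRingHom.toAlgebra
  let : Algebra (MvPolynomial G k) T.K :=
    (ι.toRingHom.comp (algebraMap (MvPolynomial G k) X)).toAlgebra
  have : IsScalarTower (MvPolynomial G k) X T.K := .of_algebraMap_eq fun _ => rfl
  have hrankX : Module.rank X T.K ≤ n := by
    refine le_trans (le_of_eq ?_) ((Module.finrank_eq_rank ι.fieldRange T.K).symm.trans_le
      (Nat.cast_le.mpr hn))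
    exact Algebra.rank_eq_of_equiv_equiv (AlgEquiv.ofInjectiveField ι).toRingEquiv (RingEquiv.refl _)
      rfl
  have : FiniteDimensional X T.K :=
    Module.rank_lt_aleph0_iff.mp (hrankX.trans_lt Cardinal.natCast_lt_aleph0)
  have : Algebra.IsAlgebraic (MvPolynomial G k) T.K :=
    (IsFractionRing.comap_isAlgebraic_iff (K := X)).mpr inferInstance
  have : FaithfulSMul (MvPolynomial G k) T.K := by
    rw [faithfulSMul_iff_algebraMap_injective]
    exact ι.injective.comp (IsFractionRing.injective (MvPolynomial G k) X)
  have hrank : Module.rank (MvPolynomial G k) T.K ≤ n := by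
    rwa [← IsLocalization.rank_eq X (nonZeroDivisors (MvPolynomial G k)) le_rfl]
  let ε : MvPolynomial G Y.K →ₐ[MvPolynomial G k] T.K :=
    { MvPolynomial.eval₂Hom φ.toRingHom fun x => algebraMap (MvPolynomial G k) T.K (.X x) with
      commutes' := fun q => by
        change MvPolynomial.eval₂Hom _ _ (MvPolynomial.map (algebraMap k Y.K) q) = _
        rw [MvPolynomial.eval₂Hom_map_hom]
        refine congrFun (congrArg DFunLike.coe (MvPolynomial.ringHom_ext (fun c => ?_)
          fun x => ?_)) q
        · rw [MvPolynomial.eval₂Hom_C]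
          exact (φ.commutes c).trans (ι.commutes c).symm
        · exact MvPolynomial.eval₂Hom_X' _ _ _ }
  have hε : ∀ q, ε (permAut (Y.action g) (MulAction.toPerm g) q) = T.action g (ε q) := by
    intro q
    induction q using MvPolynomial.induction_on with
    | C c =>
      change MvPolynomial.eval₂Hom _ _ (MvPolynomial.rename _ (MvPolynomial.map _ (.C c))) =
        T.action g (MvPolynomial.eval₂Hom _ _ (.C c))
      rw [MvPolynomial.map_C, MvPolynomial.rename_C, MvPolynomial.eval₂Hom_C,
        MvPolynomial.eval₂Hom_C]
      exact (hφ g c).symm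
    | add q r hq hr => rw [map_add, map_add, map_add, map_add, hq, hr]
    | mul_X q x hq =>
      rw [map_mul, map_mul, map_mul, map_mul, hq]
      congr 1
      change MvPolynomial.eval₂Hom _ _ (MvPolynomial.rename _ (MvPolynomial.map _ (.X x))) =
        T.action g (MvPolynomial.eval₂Hom _ _ (.X x))
      rw [MvPolynomial.map_X, MvPolynomial.rename_X, MvPolynomial.eval₂Hom_X',
        MvPolynomial.eval₂Hom_X']
      refine Eq.trans ?_ (hι g _).symm
      rw [IsFractionRing.fieldEquivOfAlgEquivHom_apply,
        IsFractionRing.fieldEquivOfAlgEquiv_algebraMap, regularAction_X]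
      rfl
  refine exists_eigenfunction_finrank_le hd hθ ε (Y.action g) (MulAction.toPerm g)
    (fun q => by rw [hε, map_eq_zero_iff _ (T.action g).injective]) (N := Nat.card G)
    (Nat.cast_ne_zero.mpr Nat.card_pos.ne') ?_ hrank
  rw [← MulAction.toPermHom_apply, ← map_pow, pow_card_eq_one', map_one]

end RegularRepresentation

section ProjectiveSpecialLinearGroup

open Matrix

variable (F : Type) [Field F]

/-- The standard transvection in `SL₂(F)`. -/
def transvectionSL : Matrix.SpecialLinearGroup (Fin 2) F :=
  ⟨!![1, 1; 0, 1], by simp⟩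

variable {F} in
/-- The diagonal matrix in `SL₂(F)` with eigenvalues `a` and `a⁻¹`. -/
def diagonalSL (a : Fˣ) : Matrix.SpecialLinearGroup (Fin 2) F :=
  ⟨!![(a : F), 0; 0, (a⁻¹ : Fˣ)], by simp⟩

theorem coe_transvectionSL_pow (m : ℕ) :
    ((transvectionSL F ^ m : Matrix.SpecialLinearGroup (Fin 2) F) : Matrix (Fin 2) (Fin 2) F) =
      !![1, (m : F); 0, 1] := by
  induction m with
  | zero => simp [Matrix.one_fin_two]
  | succ m ih =>
    rw [pow_succ, Matrix.SpecialLinearGroup.coe_mul, ih]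
    simp [transvectionSL, add_comm]

variable {F} in
theorem transvectionSL_mul_inv_diagonalSL (a : Fˣ) {m : ℕ} (hm : (m : F) = a ^ 2) :
    transvectionSL F * (diagonalSL a)⁻¹ = (diagonalSL a)⁻¹ * transvectionSL F ^ m := by
  rw [eq_inv_mul_iff_mul_eq, ← mul_assoc, mul_inv_eq_iff_eq_mul]
  apply Subtype.ext
  rw [Matrix.SpecialLinearGroup.coe_mul, Matrix.SpecialLinearGroup.coe_mul, coe_transvectionSL_pow, hm]
  simp [transvectionSL, diagonalSL, sq]

theorem orderOf_mk_transvectionSL (p : ℕ) [Fact p.Prime] :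
    orderOf (QuotientGroup.mk (transvectionSL (ZMod p)) :
      ProjectiveSpecialLinearGroup (Fin 2) (ZMod p)) = p := by
  refine orderOf_eq_prime ?_ fun h1 => ?_
  · rw [← QuotientGroup.mk_pow, show transvectionSL (ZMod p) ^ p = 1 from ?_, QuotientGroup.mk_one]
    apply Subtype.ext
    rw [coe_transvectionSL_pow, CharP.cast_eq_zero]
    exact Matrix.one_fin_two.symm
  · obtain ⟨r, -, hr⟩ := Matrix.SpecialLinearGroup.mem_center_iff.mp
      ((QuotientGroup.eq_one_iff (transvectionSL (ZMod p))).mp h1)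
    have := congrFun (congrFun hr 0) 1
    simp [transvectionSL] at this

end ProjectiveSpecialLinearGroup

section Numerics

theorem eq_of_succ_sq_modEq {p : ℕ} (hp : p.Prime) {i j : ℕ} (hi : i < (p - 1) / 2)
    (hj : j < (p - 1) / 2) (hij : (i + 1) ^ 2 ≡ (j + 1) ^ 2 [MOD p]) : i = j := by
  wlog hle : i ≤ j generalizing i j
  · exact (this hj hi hij.symm (by omega)).symm
  have hdvd := (Nat.modEq_iff_dvd' (by gcongr)).mp hij
  rw [Nat.sq_sub_sq, hp.dvd_mul] at hdvd
  obtain hdvd | hdvd := hdvd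
  · have := Nat.le_of_dvd (by omega) hdvd
    omega
  · by_contra hne
    have := Nat.le_of_dvd (by omega) hdvd
    omega

theorem not_mul_succ_le_of_le {p n c : ℕ} (hp : p.Prime) (h7 : 7 ≤ p)
    (hc : c = ((p - 1) / 2 + 1) / 2) (hn : n ≤ p - 1)
    (hsq : 168 * (n - 1) ^ 2 ≤ 168 + p * (p ^ 2 - 1)) : ¬ c * (c + 1) ≤ 2 * n := by
  intro hle
  have hodd := hp.odd_of_ne_two (by omega)
  have hp31 : p < 31 := by
    by_contra! hp31
    obtain ⟨m, rfl⟩ := hodd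
    have h8 : 8 ≤ c := by omega
    have hn' : n ≤ 4 * c := by omega
    nlinarith
  subst hc
  have hn1 : 1 ≤ n := by
    by_contra! h0
    interval_cases n
    simp at hle
    omega
  obtain ⟨m, rfl⟩ := Nat.exists_eq_add_of_le' hn1
  rw [Nat.add_sub_cancel] at hsq
  interval_cases p <;> first | (exfalso; revert hp; norm_num; done) | skip
  all_goals
    norm_num at hle hsq
    nlinarith

end Numerics

/-- Let `p ≥ 7` be prime and let `n ≥ 1` satisfy
`n ≤ min {p - 1, 1 + ⌊√(1 + p(p² - 1)/168)⌋}`.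
Then `ed_ℂ(PSL₂(𝔽_p); ≤ n) > 1`. -/
theorem edC_PSL2_gt_one (p : ℕ) [Fact p.Prime] (hp : 7 ≤ p) (n : ℕ) (hn : 1 ≤ n)
    (hn1 : (n : ℤ) ≤ (p : ℤ) - 1)
    (hn2 : (n : ℤ) ≤ 1 + ⌊Real.sqrt (1 + (p : ℝ) * ((p : ℝ) ^ 2 - 1) / 168)⌋) :
    ¬ EDLE ℂ (Matrix.ProjectiveSpecialLinearGroup (Fin 2) (ZMod p)) n 1 := by
  intro hED
  have hpp : p.Prime := Fact.out
  let mk : Matrix.SpecialLinearGroup (Fin 2) (ZMod p) →*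
    Matrix.ProjectiveSpecialLinearGroup (Fin 2) (ZMod p) := QuotientGroup.mk' _
  have hu : orderOf (mk (transvectionSL (ZMod p))) = p := orderOf_mk_transvectionSL p
  have : Nontrivial (Matrix.ProjectiveSpecialLinearGroup (Fin 2) (ZMod p)) := by
    refine ⟨mk (transvectionSL (ZMod p)), 1, fun h1 => hpp.ne_one ?_⟩
    rw [← hu, h1, orderOf_one]
  have : Finite (Matrix.ProjectiveSpecialLinearGroup (Fin 2) (ZMod p)) :=
    Finite.of_surjective mk (QuotientGroup.mk'_surjective _)
  obtain ⟨T, Y, hT, hY, hd⟩ := hED (GVariety.regular ℂ _)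
  obtain ⟨h, a, huh, htr, hfin, hdeg⟩ :=
    exists_eigenfunction_of_compression hT hY hd (mk (transvectionSL (ZMod p)))
  let act := Y.action.comp mk
  let d : Fin ((p - 1) / 2) → (ZMod p)ˣ := fun i => Units.mk0 ((i + 1 : ℕ) : ZMod p) fun h0 => by
    have := Nat.le_of_dvd (Nat.succ_pos _) ((ZMod.natCast_eq_zero_iff _ _).mp h0)
    have := i.2
    omega
  have hcount := mul_succ_le_two_mul_finrank htr
    ((orderOf_injective Y.action Y.faithful _).trans hu) (by omega) huh
    (fun i => act (diagonalSL (d i))) (fun i j => ?_) (fun i => (i + 1) ^ 2) (fun i => ?_)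
    (fun i hi => ?_) (fun i j hij => Fin.ext (eq_of_succ_sq_modEq hpp i.2 j.2 hij))
    (c := ((p - 1) / 2 + 1) / 2) (by rw [Fintype.card_fin]; omega)
  · refine not_mul_succ_le_of_le hpp hp rfl (n := n) (by omega) ?_
      (hcount.trans (Nat.mul_le_mul_left 2 hdeg))
    obtain ⟨m, rfl⟩ := Nat.exists_eq_add_of_le' hn
    have hsqrt : (m : ℝ) ≤ Real.sqrt (1 + (p : ℝ) * ((p : ℝ) ^ 2 - 1) / 168) := by
      have : (m : ℤ) ≤ ⌊Real.sqrt (1 + (p : ℝ) * ((p : ℝ) ^ 2 - 1) / 168)⌋ := by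
        push_cast at hn2
        linarith
      exact_mod_cast Int.le_floor.mp this
    have hnonneg : 0 ≤ (p : ℝ) * ((p : ℝ) ^ 2 - 1) :=
      mul_nonneg p.cast_nonneg (sub_nonneg.mpr (one_le_pow₀ (Nat.one_le_cast.mpr hpp.one_le)))
    rw [Real.le_sqrt (Nat.cast_nonneg m) (by positivity)] at hsqrt
    rw [Nat.add_sub_cancel, ← Nat.cast_le (α := ℝ)]
    push_cast [Nat.cast_sub (one_le_pow₀ hpp.one_le : 1 ≤ p ^ 2)]
    linarith
  · rw [← map_inv, ← map_mul]
    exact act.isOfFinOrder (isOfFinOrder_of_finite _)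
  · change act _ * (act _)⁻¹ = (act _)⁻¹ * act _ ^ _
    rw [← map_inv, ← map_mul, ← map_pow, ← map_mul, transvectionSL_mul_inv_diagonalSL]
    simp [d]
  · have := Nat.le_of_dvd (Nat.succ_pos _) (hpp.dvd_of_dvd_pow hi)
    have := i.2
    omega
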